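/- The commutator subgroup of the group Homeo(ℝ²) of self-homeomorphisms of the Euclidean plane has index 2 in Homeo(ℝ²). -/

import Mathlib

open Pointwise

instance instGroupHomeomorph (X : Type*) [TopologicalSpace X] : Group (X ≃ₜ X) where
  mul f g := g.trans f
  one := Homeomorph.refl X
  inv := Homeomorph.symm
  mul_assoc _ _ _ := Homeomorph.ext fun _ => rfl
  one_mul _ := Homeomorph.ext fun _ => rfl
  mul_one _ := Homeomorph.ext fun _ => rfl
  inv_mul_cancel f := Homeomorph.ext fun x => f.symm_apply_apply x

open Filter Topology Metric Set

theorem Homeomorph.mul_apply' {X : Type*} [TopologicalSpace X] (f g : X ≃ₜ X) (x : X) :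
    (f * g) x = f (g x) := rfl

theorem Homeomorph.one_apply' {X : Type*} [TopologicalSpace X] (x : X) :
    (1 : X ≃ₜ X) x = x := rfl

theorem Homeomorph.inv_apply_self' {X : Type*} [TopologicalSpace X] (f : X ≃ₜ X) (x : X) :
    f⁻¹ (f x) = x := f.symm_apply_apply x

theorem Homeomorph.apply_inv_self' {X : Type*} [TopologicalSpace X] (f : X ≃ₜ X) (x : X) :
    f (f⁻¹ x) = x := f.apply_symm_apply x

theorem mul_mul_inv_mul_inv_mem_commutator {G : Type*} [Group G] (a b : G) :
    a * b * a⁻¹ * b⁻¹ ∈ commutator G :=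
  Subgroup.commutator_mem_commutator (Subgroup.mem_top a) (Subgroup.mem_top b)

/-- A continuous proper bijection between the plane and itself is a homeomorphism. -/
theorem exists_homeomorph_of_bijective {T : ℂ → ℂ} (hc : Continuous T)
    (hb : Function.Bijective T) (ht : Tendsto (fun z => ‖T z‖) (cocompact ℂ) atTop) :
    ∃ h : ℂ ≃ₜ ℂ, ∀ z, h z = T z := by
  have hp : IsProperMap T := by
    rw [isProperMap_iff_tendsto_cocompact]
    refine ⟨hc, ?_⟩
    rw [← Metric.cobounded_eq_cocompact, ← tendsto_norm_atTop_iff_cobounded,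
      Metric.cobounded_eq_cocompact]
    exact ht
  refine ⟨(Equiv.ofBijective T hb).toHomeomorphOfContinuousClosed hc hp.isClosedMap, fun z => rfl⟩

theorem norm_inv_pow_le {B : ℂ ≃ₜ ℂ} (hB : ∀ x, 2 * ‖x‖ ≤ ‖B x‖) (n : ℕ) (x : ℂ) :
    2 ^ n * ‖((B⁻¹) ^ n) x‖ ≤ ‖x‖ := by
  induction n generalizing x with
  | zero => simp
  | succ n ih =>
    have h1 := hB (B⁻¹ (((B⁻¹) ^ n) x))
    rw [Homeomorph.apply_inv_self'] at h1
    rw [pow_succ' (B⁻¹), Homeomorph.mul_apply', pow_succ]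
    have := ih x
    have h2 : (0:ℝ) < 2 ^ n := by positivity
    nlinarith [norm_nonneg (B⁻¹ (((B⁻¹) ^ n) x))]

theorem pow_mul_inv_pow_stable {A B : ℂ ≃ₜ ℂ} (hB : ∀ x, 2 * ‖x‖ ≤ ‖B x‖) {r : ℝ}
    (hAB : ∀ x, ‖x‖ < r → A x = B x) {x : ℂ} {n m : ℕ} (hnm : n ≤ m) (hx : ‖x‖ < 2 ^ n * r) :
    (A ^ m * (B⁻¹) ^ m) x = (A ^ n * (B⁻¹) ^ n) x := by
  induction m, hnm using Nat.le_induction with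
  | base => rfl
  | succ m hm ih =>
    rw [← ih, pow_succ A, pow_succ' (B⁻¹)]
    simp only [Homeomorph.mul_apply']
    congr 1
    have h0 : 0 < r := by
      have := norm_nonneg x
      have h2 : (0:ℝ) < 2 ^ n := by positivity
      by_contra! h
      nlinarith
    have h3 : (2:ℝ) ^ n ≤ 2 ^ m := pow_le_pow_right₀ (by norm_num) hm
    have h1 : ‖((B⁻¹) ^ (m + 1)) x‖ < r := by
      have := norm_inv_pow_le hB (m + 1) x
      rw [pow_succ] at this
      have h2 : (0:ℝ) < 2 ^ m := by positivity
      by_contra! h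
      nlinarith
    rw [pow_succ' (B⁻¹), Homeomorph.mul_apply'] at h1
    exact (hAB _ h1).trans (Homeomorph.apply_inv_self' _ _)

/-- Two uniformly expanding homeomorphisms that agree near the origin are conjugate. -/
theorem mul_inv_mem_commutator_of_expanding {A B : ℂ ≃ₜ ℂ} (hA : ∀ x, 2 * ‖x‖ ≤ ‖A x‖)
    (hB : ∀ x, 2 * ‖x‖ ≤ ‖B x‖) {r : ℝ} (hr : 0 < r) (hAB : ∀ x, ‖x‖ < r → A x = B x) :
    A * B⁻¹ ∈ commutator (ℂ ≃ₜ ℂ) := by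
  have hN : ∀ x : ℂ, ∃ n : ℕ, ‖x‖ < 2 ^ n * r := by
    intro x
    obtain ⟨n, hn⟩ := pow_unbounded_of_one_lt (‖x‖ / r) (one_lt_two)
    exact ⟨n, by rwa [div_lt_iff₀ hr] at hn⟩
  choose N hN using hN
  have key : ∀ {A B : ℂ ≃ₜ ℂ}, (∀ x, 2 * ‖x‖ ≤ ‖B x‖) → (∀ x, ‖x‖ < r → A x = B x) →
      Continuous (fun x => (A ^ N x * (B⁻¹) ^ N x) x) := by
    intro A B hB hAB
    rw [continuous_iff_continuousAt]
    intro x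
    have : ∀ᶠ y in 𝓝 x, (A ^ N y * (B⁻¹) ^ N y) y = (A ^ N x * (B⁻¹) ^ N x) y := by
      filter_upwards [(isOpen_lt continuous_norm continuous_const).mem_nhds (hN x)] with y hy
      rcases le_total (N x) (N y) with h | h
      · exact pow_mul_inv_pow_stable hB hAB h hy
      · exact (pow_mul_inv_pow_stable hB hAB h (hN y)).symm
    exact ((A ^ N x * (B⁻¹) ^ N x).continuous.continuousAt).congr (this.mono fun y hy => hy.symm)
  have inv : ∀ {A B : ℂ ≃ₜ ℂ}, (∀ x, 2 * ‖x‖ ≤ ‖A x‖) → (∀ x, 2 * ‖x‖ ≤ ‖B x‖) →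
      (∀ x, ‖x‖ < r → A x = B x) → ∀ x,
      (fun x => (B ^ N x * (A⁻¹) ^ N x) x) ((fun x => (A ^ N x * (B⁻¹) ^ N x) x) x) = x := by
    intro A B hA hB hAB x
    simp only
    set y := (A ^ N x * (B⁻¹) ^ N x) x with hy
    have h1 : y = (A ^ (max (N x) (N y)) * (B⁻¹) ^ (max (N x) (N y))) x :=
      (pow_mul_inv_pow_stable hB hAB (le_max_left _ _) (hN x)).symm
    rw [← pow_mul_inv_pow_stable hA (fun x hx => (hAB x hx).symm)
      (le_max_right (N x) (N y)) (hN y)]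
    nth_rewrite 3 [h1]
    rw [← Homeomorph.mul_apply']
    have : B ^ max (N x) (N y) * A⁻¹ ^ max (N x) (N y) *
      (A ^ max (N x) (N y) * B⁻¹ ^ max (N x) (N y)) = 1 := by
      simp only [inv_pow]; group
    rw [this]; rfl
  let ψ : ℂ ≃ₜ ℂ :=
    { toFun := fun x => (A ^ N x * (B⁻¹) ^ N x) x
      invFun := fun x => (B ^ N x * (A⁻¹) ^ N x) x
      left_inv := inv hA hB hAB
      right_inv := inv hB hA (fun x hx => (hAB x hx).symm)
      continuous_toFun := key hB hAB
      continuous_invFun := key hA (fun x hx => (hAB x hx).symm) }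
  have hψ : ∀ x, ψ x = (A ^ N x * (B⁻¹) ^ N x) x := fun x => rfl
  have hconj : A * ψ = ψ * B := by
    ext1 x
    rw [Homeomorph.mul_apply', Homeomorph.mul_apply', hψ, hψ]
    have h1 := pow_mul_inv_pow_stable hB hAB (le_max_left (N x) (N (B x))) (hN x)
    have h2 := pow_mul_inv_pow_stable hB hAB
      ((le_max_right (N x) (N (B x))).trans (Nat.le_succ _)) (hN (B x))
    rw [← h1, ← h2, ← Homeomorph.mul_apply', ← Homeomorph.mul_apply']
    congr 1
    simp only [inv_pow, pow_succ' A, pow_succ B]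
    group
  have : A * B⁻¹ = ψ * B * ψ⁻¹ * B⁻¹ := by
    rw [← hconj]; group
  rw [this]
  exact mul_mul_inv_mul_inv_mem_commutator ψ B

/-- The homeomorphism `z ↦ u(‖z‖) z`, for a continuous complex-valued function `u` such that
`s ↦ s ‖u(s)‖` is an increasing bijection of the half-line. -/
theorem exists_homeomorph_radial {u : ℝ → ℂ} (hu : Continuous u)
    (hm : StrictMonoOn (fun s => s * ‖u s‖) (Ici 0))
    (ht : Tendsto (fun s => s * ‖u s‖) atTop atTop) :
    ∃ h : ℂ ≃ₜ ℂ, ∀ z, h z = u ‖z‖ * z := by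
  have hn : ∀ z : ℂ, ‖u ‖z‖ * z‖ = ‖z‖ * ‖u ‖z‖‖ := fun z => by rw [norm_mul, mul_comm]
  have hu0 : ∀ s : ℝ, 0 < s → u s ≠ 0 := by
    intro s hs h
    have := hm (mem_Ici.2 le_rfl) (mem_Ici.2 hs.le) hs
    simp [h] at this
  refine exists_homeomorph_of_bijective (T := fun z => u ‖z‖ * z) (by fun_prop) ⟨?_, ?_⟩ ?_
  · intro z w h
    have h1 : ‖z‖ = ‖w‖ := by
      have h2 := congrArg norm h
      simp only [hn] at h2
      exact hm.injOn (mem_Ici.2 (norm_nonneg z)) (mem_Ici.2 (norm_nonneg w)) h2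
    simp only [h1] at h
    rcases (norm_nonneg w).eq_or_lt with h3 | h3
    · rw [← h3, norm_eq_zero] at h1
      rw [eq_comm, norm_eq_zero] at h3
      rw [h1, h3]
    · exact mul_left_cancel₀ (hu0 _ h3) h
  · intro w
    have hc : ContinuousOn (fun s : ℝ => s * ‖u s‖) (Ici 0) := by fun_prop
    obtain ⟨S, hS, hS0⟩ := ((ht.eventually_ge_atTop ‖w‖).and (eventually_ge_atTop 0)).exists
    obtain ⟨s, ⟨hs0, -⟩, hs⟩ := intermediate_value_Icc hS0 (hc.mono Icc_subset_Ici_self)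
      (show ‖w‖ ∈ Icc _ _ from ⟨by simp, hS⟩)
    simp only at hs
    rcases hs0.eq_or_lt with h | h
    · refine ⟨0, ?_⟩
      rw [← h, zero_mul, eq_comm, norm_eq_zero] at hs
      simp [hs]
    · have h1 : ‖w / u s‖ = s := by
        rw [norm_div, ← hs, mul_div_assoc, div_self (norm_ne_zero_iff.2 (hu0 s h)), mul_one]
      refine ⟨w / u s, ?_⟩
      simp only [h1]
      rw [mul_div_cancel₀ _ (hu0 s h)]
  · simp only [hn]
    exact ht.comp tendsto_norm_cocompact_atTop

/-- A homeomorphism of the plane fixing a neighborhood of the origin is a product of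
commutators. -/
theorem mem_commutator_of_eq_id_near_zero {h : ℂ ≃ₜ ℂ} {r : ℝ} (hr : 0 < r)
    (hh : ∀ x, ‖x‖ < r → h x = x) : h ∈ commutator (ℂ ≃ₜ ℂ) := by
  set m : ℝ → ℝ := fun s => sSup ((fun y : ℂ => ‖h⁻¹ (s * y)‖) '' closedBall 0 1) with hmdef
  have hcomp : IsCompact (closedBall (0:ℂ) 1) := isCompact_closedBall _ _
  have hcont' : ∀ s : ℝ, Continuous (fun y : ℂ => ‖h⁻¹ (s * y)‖) := fun s =>
    (h⁻¹.continuous.comp (by fun_prop)).norm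
  have hmc : Continuous m := by
    refine hcomp.continuous_sSup (f := fun (s : ℝ) (y : ℂ) => ‖h⁻¹ (s * y)‖) ?_
    exact (h⁻¹.continuous.comp (by fun_prop : Continuous fun p : ℝ × ℂ => (p.1 : ℂ) * p.2)).norm
  have hle : ∀ (s : ℝ) (y : ℂ), ‖y‖ ≤ s → ‖h⁻¹ y‖ ≤ m s := by
    intro s y hy
    rcases ((norm_nonneg y).trans hy).eq_or_lt with h0 | h0
    · refine le_csSup ((hcomp.image (hcont' s)).bddAbove) ⟨0, by simp, ?_⟩
      rw [← h0, norm_le_zero_iff] at hy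
      simp [hy]
    · refine le_csSup ((hcomp.image (hcont' s)).bddAbove) ⟨y / s, ?_, ?_⟩
      · simp only [mem_closedBall, dist_zero_right, norm_div, Complex.norm_real, Real.norm_eq_abs,
          abs_of_pos h0]
        rwa [div_le_one h0]
      · simp only
        rw [mul_div_cancel₀ _ (by exact_mod_cast h0.ne')]
  have hmono : ∀ s t : ℝ, 0 ≤ s → s ≤ t → m s ≤ m t := by
    intro s t hs hst
    refine csSup_le ((nonempty_closedBall.2 zero_le_one).image _) ?_
    rintro _ ⟨y, hy, rfl⟩
    refine hle t _ ?_
    rw [norm_mul, Complex.norm_real, Real.norm_eq_abs, abs_of_nonneg hs]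
    rw [mem_closedBall, dist_zero_right] at hy
    nlinarith [norm_nonneg y]
  have hm0 : ∀ s : ℝ, 0 ≤ s → 0 ≤ m s := fun s hs => (norm_nonneg _).trans (hle s 0 (by simpa))
  set v : ℝ → ℝ := fun s => 2 + 2 / r * m (max s 0) with hv
  have hvc : Continuous v := by
    have : Continuous fun s => m (max s 0) := hmc.comp (by fun_prop)
    fun_prop
  have hv2 : ∀ s, 2 ≤ v s := fun s => by
    have := hm0 (max s 0) (le_max_right _ _)
    simp only [hv]
    have : 0 ≤ 2 / r * m (max s 0) := by positivity
    linarith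
  have hvn : ∀ s, ‖(v s : ℂ)‖ = v s := fun s => by
    rw [Complex.norm_real, Real.norm_eq_abs, abs_of_nonneg (by linarith [hv2 s])]
  have hvm : ∀ s t : ℝ, s ≤ t → v s ≤ v t := by
    intro s t hst
    simp only [hv]
    have := hmono (max s 0) (max t 0) (le_max_right _ _) (max_le_max_right 0 hst)
    gcongr
  obtain ⟨ρ, hρ⟩ := exists_homeomorph_radial (u := fun s => (v s : ℂ)) (by fun_prop)
    (by
      intro s hs t ht hst
      simp only [hvn]
      have := hvm s t hst.le
      have := hv2 s
      rw [mem_Ici] at hs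
      nlinarith)
    (by
      simp only [hvn]
      refine tendsto_atTop_mono' _ ?_ tendsto_id
      filter_upwards [eventually_ge_atTop 0] with s hs
      have := hv2 s
      simp only [id]
      nlinarith)
  have hρn : ∀ z, ‖ρ z‖ = v ‖z‖ * ‖z‖ := fun z => by rw [hρ, norm_mul, hvn]
  have h1 : ∀ x, 2 * ‖x‖ ≤ ‖ρ x‖ := fun x => by
    rw [hρn]; exact mul_le_mul_of_nonneg_right (hv2 _) (norm_nonneg _)
  have h2 : ∀ x, 2 * ‖x‖ ≤ ‖(ρ * h) x‖ := by
    intro x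
    rw [Homeomorph.mul_apply']
    by_cases hx : ‖h x‖ < r
    · have : h x = x := h.injective (hh _ hx)
      rw [this]; exact h1 x
    · rw [hρn]
      have h3 := hle ‖h x‖ (h x) le_rfl
      rw [Homeomorph.inv_apply_self'] at h3
      simp only [hv, max_eq_left (norm_nonneg (h x))]
      push Not at hx
      have h4 : 2 * m ‖h x‖ ≤ 2 / r * m ‖h x‖ * ‖h x‖ := by
        rw [div_mul_eq_mul_div, div_mul_eq_mul_div, le_div_iff₀ hr]
        have := hm0 ‖h x‖ (norm_nonneg _)
        nlinarith
      nlinarith [norm_nonneg (h x)]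
  have h3 := mul_inv_mem_commutator_of_expanding h2 h1 hr (fun x hx => by
    rw [Homeomorph.mul_apply', hh x hx])
  simpa [mul_assoc] using (inferInstance : (commutator (ℂ ≃ₜ ℂ)).Normal).conj_mem _ h3 ρ⁻¹

theorem mem_commutator_of_eq_id_on_ball {h : ℂ ≃ₜ ℂ} {c : ℂ} {r : ℝ} (hr : 0 < r)
    (hh : ∀ x ∈ ball c r, h x = x) : h ∈ commutator (ℂ ≃ₜ ℂ) := by
  have h1 : (Homeomorph.addRight c)⁻¹ * h * Homeomorph.addRight c ∈ commutator (ℂ ≃ₜ ℂ) := by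
    refine mem_commutator_of_eq_id_near_zero hr fun x hx => ?_
    have : h (Homeomorph.addRight c x) = Homeomorph.addRight c x := hh _ (by simpa using hx)
    rw [Homeomorph.mul_apply', Homeomorph.mul_apply', this, Homeomorph.inv_apply_self']
  simpa [mul_assoc] using (inferInstance : (commutator (ℂ ≃ₜ ℂ)).Normal).conj_mem _ h1
    (Homeomorph.addRight c)

theorem mem_commutator_of_eqOn_open {h k : ℂ ≃ₜ ℂ} (hk : k ∈ commutator (ℂ ≃ₜ ℂ)) {U : Set ℂ}
    (hU : IsOpen U) (hne : U.Nonempty) (hh : ∀ x ∈ U, h x = k x) : h ∈ commutator (ℂ ≃ₜ ℂ) := by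
  obtain ⟨c, hc⟩ := hne
  obtain ⟨r, hr, hrU⟩ := Metric.isOpen_iff.1 hU c hc
  have h1 : k⁻¹ * h ∈ commutator (ℂ ≃ₜ ℂ) := by
    refine mem_commutator_of_eq_id_on_ball (c := c) hr fun x hx => ?_
    rw [Homeomorph.mul_apply', hh x (hrU hx), Homeomorph.inv_apply_self']
  simpa using mul_mem hk h1

/-- Multiplication by a nonzero complex number is a product of commutators. -/
theorem mulLeft_mem_commutator {a : ℂ} (ha : a ≠ 0) :
    Homeomorph.mulLeft₀ a ha ∈ commutator (ℂ ≃ₜ ℂ) := by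
  wlog h1 : ‖a‖ ≤ 1 generalizing a
  · have h2 := this (inv_ne_zero ha) (by
      rw [norm_inv]; push Not at h1; exact inv_le_one_of_one_le₀ h1.le)
    have h3 : Homeomorph.mulLeft₀ a ha = (Homeomorph.mulLeft₀ a⁻¹ (inv_ne_zero ha))⁻¹ := by
      rw [eq_inv_iff_mul_eq_one]
      ext1 x
      change a * (a⁻¹ * x) = x
      rw [mul_inv_cancel_left₀ ha]
    rw [h3]
    exact inv_mem h2
  set w : ℂ := Complex.log a
  have hw : w.re ≤ 0 := by
    rw [Complex.log_re]; exact Real.log_nonpos (norm_nonneg _) h1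
  set t : ℝ → ℝ := fun s => max 0 (min 1 (2 - s)) with ht
  have htc : Continuous t := by fun_prop
  have hta : ∀ s s', s ≤ s' → t s' ≤ t s := fun s s' h => by
    simp only [ht]; gcongr
  have ht0 : ∀ s, 0 ≤ t s := fun s => le_max_left _ _
  have hn : ∀ s, ‖Complex.exp (t s * w)‖ = Real.exp (t s * w.re) := fun s => by
    rw [Complex.norm_exp]; simp
  obtain ⟨Q, hQ⟩ := exists_homeomorph_radial (u := fun s => Complex.exp (t s * w)) (by fun_prop)
    (by
      intro s hs s' hs' hss
      simp only [hn]
      have h2 : Real.exp (t s * w.re) ≤ Real.exp (t s' * w.re) := by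
        rw [Real.exp_le_exp]
        have := hta s s' hss.le
        nlinarith
      have h3 := Real.exp_pos (t s * w.re)
      rw [mem_Ici] at hs
      nlinarith)
    (by
      simp only [hn]
      refine tendsto_atTop_mono' _ ?_ tendsto_id
      filter_upwards [eventually_ge_atTop 2] with s hs
      have : t s = 0 := by
        simp only [ht]; rw [max_eq_left]; exact (min_le_right _ _).trans (by linarith)
      simp [this])
  have hQm : Q ∈ commutator (ℂ ≃ₜ ℂ) := by
    refine mem_commutator_of_eq_id_on_ball (c := 3) (r := 1) one_pos fun x hx => ?_
    have h2 : 2 ≤ ‖x‖ := by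
      rw [mem_ball, dist_eq_norm] at hx
      have := norm_sub_norm_le (3:ℂ) x
      rw [norm_sub_rev] at this
      have h3 : ‖(3:ℂ)‖ = 3 := by norm_num
      linarith
    have : t ‖x‖ = 0 := by
      simp only [ht]; rw [max_eq_left]; exact (min_le_right _ _).trans (by linarith)
    rw [hQ, this]; simp
  refine mem_commutator_of_eqOn_open hQm (isOpen_ball (x := (0:ℂ)) (ε := 1)) ⟨0, by simp⟩ ?_
  intro x hx
  rw [mem_ball, dist_zero_right] at hx
  have : t ‖x‖ = 1 := by
    simp only [ht]; rw [min_eq_left (by linarith)]; simp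
  rw [hQ, this]
  simp only [Complex.ofReal_one, one_mul]
  rw [Complex.exp_log ha]
  rfl

theorem addRight_mem_commutator (c : ℂ) : Homeomorph.addRight c ∈ commutator (ℂ ≃ₜ ℂ) := by
  have h2 : (2:ℂ) ≠ 0 := two_ne_zero
  have := mul_mul_inv_mul_inv_mem_commutator (Homeomorph.mulLeft₀ (2:ℂ) h2)
    (Homeomorph.addRight c)
  convert this using 1
  rw [eq_mul_inv_iff_mul_eq, eq_mul_inv_iff_mul_eq]
  ext1 x
  change 2 * x + c + c = 2 * (x + c)
  ring

/-- A homeomorphism of the plane that is conformal at some point is a product of commutators. -/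
theorem mem_commutator_of_hasStrictDerivAt {h : ℂ ≃ₜ ℂ} {a c : ℂ} (ha : a ≠ 0)
    (hh : HasStrictDerivAt h a c) : h ∈ commutator (ℂ ≃ₜ ℂ) := by
  set k : ℂ ≃ₜ ℂ := Homeomorph.mulLeft₀ a⁻¹ (inv_ne_zero ha) * Homeomorph.addRight (-(h c)) * h *
    Homeomorph.addRight c with hk
  have hkf : ∀ z, k z = a⁻¹ * (h (z + c) + -(h c)) := fun z => rfl
  have hk0 : k 0 = 0 := by simp [hkf]
  have hkd : HasStrictDerivAt k 1 0 := by
    have h1 : HasStrictDerivAt (fun z => h (z + c)) a 0 := by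
      have h3 : HasStrictDerivAt (fun z : ℂ => z + c) 1 0 := (hasStrictDerivAt_id 0).add_const c
      have h4 : HasStrictDerivAt h a ((fun z : ℂ => z + c) 0) := by simpa using hh
      have h5 := h4.comp (0 : ℂ) h3
      rw [mul_one] at h5
      exact h5
    have h2 := (h1.add_const (-(h c))).const_mul a⁻¹
    rw [inv_mul_cancel₀ ha] at h2
    exact h2
  suffices hkm : k ∈ commutator (ℂ ≃ₜ ℂ) by
    have : h = (Homeomorph.mulLeft₀ a⁻¹ (inv_ne_zero ha) * Homeomorph.addRight (-(h c)))⁻¹ * k *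
      (Homeomorph.addRight c)⁻¹ := by rw [hk]; group
    rw [this]
    exact mul_mem (mul_mem (inv_mem (mul_mem (mulLeft_mem_commutator _)
      (addRight_mem_commutator _))) hkm) (inv_mem (addRight_mem_commutator _))
  have hkF : HasStrictFDerivAt k ((ContinuousLinearEquiv.refl ℝ ℂ : ℂ ≃L[ℝ] ℂ) : ℂ →L[ℝ] ℂ) 0 := by
    have := hkd.hasStrictFDerivAt.restrictScalars ℝ
    have h2 : ((ContinuousLinearEquiv.refl ℝ ℂ : ℂ ≃L[ℝ] ℂ) : ℂ →L[ℝ] ℂ) =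
        (ContinuousLinearMap.toSpanSingleton ℂ (1 : ℂ)).restrictScalars ℝ := by
      ext z; simp
    rw [h2]
    exact this
  have hL : 0 < lipschitzExtensionConstant ℂ := lipschitzExtensionConstant_pos ℂ
  set C : NNReal := (2 * lipschitzExtensionConstant ℂ)⁻¹ with hC
  have hC0 : 0 < C := by positivity
  obtain ⟨s, hs, hsa⟩ := hkF.approximates_deriv_on_nhds (Or.inr hC0)
  obtain ⟨r, hr, hrs⟩ := Metric.mem_nhds_iff.1 hs
  classical
  set f : ℂ → ℂ := fun z => if ‖z‖ < r then k z else z with hf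
  have hb : ∀ x, ‖x‖ < r → ‖k x - x‖ ≤ C * ‖x‖ := by
    intro x hx
    have := hsa x (hrs (by simpa using hx)) 0 (hrs (mem_ball_self hr))
    simpa [hk0] using this
  have hfa : ApproximatesLinearOn f ((ContinuousLinearEquiv.refl ℝ ℂ : ℂ ≃L[ℝ] ℂ) : ℂ →L[ℝ] ℂ)
      (ball 0 r ∪ (ball 0 (2 * r))ᶜ) C := by
    have hmix : ∀ x y, ‖x‖ < r → 2 * r ≤ ‖y‖ → ‖k x - x‖ ≤ C * ‖x - y‖ := by
      intro x y hx hy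
      refine (hb x hx).trans ?_
      have := norm_sub_norm_le y x
      rw [norm_sub_rev] at this
      gcongr
      linarith
    have hC1 : ∀ x y : ℂ, 0 ≤ (C:ℝ) * ‖x - y‖ := fun x y => by positivity
    intro x hx y hy
    simp only [mem_union, mem_ball, dist_zero_right, mem_compl_iff, not_lt] at hx hy
    simp only [hf, ContinuousLinearEquiv.coe_refl, ContinuousLinearMap.coe_id', id]
    rcases hx with hx | hx <;> rcases hy with hy | hy
    · rw [if_pos hx, if_pos hy]
      exact hsa x (hrs (by simpa using hx)) y (hrs (by simpa using hy))
    · rw [if_pos hx, if_neg (by linarith)]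
      convert hmix x y hx hy using 1
      congr 1
      exact sub_sub_sub_cancel_right ..
    · rw [if_neg (by linarith), if_pos hy]
      rw [norm_sub_rev x y]
      convert hmix y x hy hx using 1
      rw [← norm_neg]
      congr 1
      ring
    · rw [if_neg (by linarith), if_neg (by linarith), sub_self, norm_zero]
      exact hC1 x y
  obtain ⟨g, hg⟩ := hfa.exists_homeomorph_extension (Or.inr (by
    have : ‖((ContinuousLinearEquiv.refl ℝ ℂ).symm : ℂ →L[ℝ] ℂ)‖₊ = 1 := by
      rw [ContinuousLinearEquiv.refl_symm]
      exact ContinuousLinearMap.nnnorm_id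
    rw [this, inv_one, hC, mul_inv, mul_comm, mul_assoc, inv_mul_cancel₀ hL.ne', mul_one]
    rw [← NNReal.coe_lt_coe]; norm_num))
  have hgm : g ∈ commutator (ℂ ≃ₜ ℂ) := by
    refine mem_commutator_of_eq_id_on_ball (c := ((3 * r : ℝ) : ℂ)) hr fun x hx => ?_
    have h2 : 2 * r ≤ ‖x‖ := by
      rw [mem_ball, dist_eq_norm] at hx
      have := norm_sub_norm_le ((3 * r : ℝ) : ℂ) x
      rw [norm_sub_rev, Complex.norm_real, Real.norm_eq_abs, abs_of_pos (by positivity)] at this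
      linarith
    rw [← hg (Or.inr (by simpa using h2))]
    simp only [hf]
    rw [if_neg (by linarith)]
  refine mem_commutator_of_eqOn_open hgm (isOpen_ball (x := (0:ℂ)) (ε := r)) ⟨0, by simpa⟩ ?_
  intro x hx
  rw [← hg (Or.inl hx)]
  simp only [hf]
  rw [if_pos (by simpa using hx)]

/-- `HasDegree h d` says that `h` induces multiplication by `d` on the fundamental group of a
punctured plane: the maps `z ↦ h (a + exp z) - h a` lift through the exponential to maps that
turn translation by `2πi` into translation by `2πi d`. -/
def HasDegree (h : ℂ ≃ₜ ℂ) (d : ℤ) : Prop :=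
  ∃ L : ℂ × ℂ → ℂ, Continuous L ∧ (∀ a z, Complex.exp (L (a, z)) = h (a + Complex.exp z) - h a) ∧
    ∀ a z, L (a, z + 2 * Real.pi * Complex.I) = L (a, z) + d * (2 * Real.pi * Complex.I)

theorem exists_int_const_of_exp_eq {X : Type*} [TopologicalSpace X] [PreconnectedSpace X]
    [Nonempty X] {f g : X → ℂ} (hf : Continuous f) (hg : Continuous g)
    (h : ∀ x, Complex.exp (f x) = Complex.exp (g x)) :
    ∃ d : ℤ, ∀ x, f x = g x + d * (2 * Real.pi * Complex.I) := by
  have h1 : ∀ x, ∃ n : ℤ, f x = g x + n * (2 * Real.pi * Complex.I) := fun x =>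
    Complex.exp_eq_exp_iff_exists_int.1 (h x)
  choose n hn using h1
  have hI := Complex.two_pi_I_ne_zero
  have hnc : Continuous n := by
    have h2 : Continuous (fun x => ((n x : ℤ) : ℂ)) := by
      have : (fun x => ((n x : ℤ) : ℂ)) = fun x => (f x - g x) / (2 * Real.pi * Complex.I) := by
        ext x
        rw [hn x, add_sub_cancel_left, mul_div_cancel_right₀ _ hI]
      rw [this]
      fun_prop
    have h3 : Continuous (fun x => ((n x : ℤ) : ℝ)) := by
      refine (Complex.continuous_re.comp h2).congr fun x => ?_
      simp
    exact Int.isClosedEmbedding_coe_real.isEmbedding.continuous_iff.2 h3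
  obtain ⟨x0⟩ := ‹Nonempty X›
  refine ⟨n x0, fun x => ?_⟩
  rw [hn x, PreconnectedSpace.constant inferInstance hnc (x := x) (y := x0)]

theorem Convex.isSimplyConnected {E : Type*} [AddCommGroup E] [Module ℝ E] [TopologicalSpace E]
    [ContinuousAdd E] [ContinuousSMul ℝ E] {s : Set E} (hs : Convex ℝ s) (hne : s.Nonempty) :
    IsSimplyConnected s := by
  have := hs.contractibleSpace hne
  exact inferInstanceAs (SimplyConnectedSpace s)

theorem exists_hasDegree (h : ℂ ≃ₜ ℂ) : ∃ d, HasDegree h d := by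
  obtain ⟨L, hL, hLe⟩ := Complex.exists_continuousOn_eqOn_exp_comp (X := ℂ × ℂ) (U := univ)
    ((convex_univ (𝕜 := ℝ)).isSimplyConnected univ_nonempty)
    isOpen_univ (g := fun p => h (p.1 + Complex.exp p.2) - h p.1)
    (by
      refine Continuous.continuousOn ?_
      exact (h.continuous.comp (by fun_prop)).sub (h.continuous.comp continuous_fst))
    (by
      rintro ⟨p, -, hp⟩
      simp only at hp
      rw [sub_eq_zero] at hp
      exact Complex.exp_ne_zero p.2 (left_eq_add.1 (h.injective hp).symm))
  rw [continuousOn_univ] at hL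
  have hLe' : ∀ a z, Complex.exp (L (a, z)) = h (a + Complex.exp z) - h a := fun a z =>
    hLe (mem_univ (a, z))
  obtain ⟨d, hd⟩ := exists_int_const_of_exp_eq (X := ℂ × ℂ)
    (f := fun p => L (p.1, p.2 + 2 * Real.pi * Complex.I)) (g := L)
    (hL.comp (by fun_prop)) hL (by
      rintro ⟨a, z⟩
      simp only [hLe', Complex.exp_periodic z])
  exact ⟨d, L, hL, hLe', fun a z => hd (a, z)⟩

theorem HasDegree.unique {h : ℂ ≃ₜ ℂ} {d d' : ℤ} (H : HasDegree h d) (H' : HasDegree h d') :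
    d = d' := by
  obtain ⟨L, hL, hLe, hLd⟩ := H
  obtain ⟨L', hL', hLe', hLd'⟩ := H'
  obtain ⟨n, hn⟩ := exists_int_const_of_exp_eq hL hL' (by
    rintro ⟨a, z⟩
    rw [hLe, hLe'])
  have h1 := hLd 0 0
  rw [hn, hn, hLd'] at h1
  have hI := Complex.two_pi_I_ne_zero
  have h2 : (d' : ℂ) * (2 * Real.pi * Complex.I) = d * (2 * Real.pi * Complex.I) := by
    linear_combination h1
  exact_mod_cast (mul_right_cancel₀ hI h2).symm

theorem HasDegree.add_int_mul {L : ℂ × ℂ → ℂ} {d : ℤ}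
    (hd : ∀ a z, L (a, z + 2 * Real.pi * Complex.I) = L (a, z) + d * (2 * Real.pi * Complex.I))
    (a z : ℂ) (n : ℤ) : L (a, z + n * (2 * Real.pi * Complex.I)) =
      L (a, z) + n * d * (2 * Real.pi * Complex.I) := by
  induction n using Int.induction_on with
  | zero => simp
  | succ n ih =>
    have := hd a (z + n * (2 * Real.pi * Complex.I))
    push_cast at ih ⊢
    rw [ih] at this
    rw [show z + (n + 1) * (2 * Real.pi * Complex.I) =
      z + n * (2 * Real.pi * Complex.I) + 2 * Real.pi * Complex.I by ring, this]
    ring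
  | pred n ih =>
    have := hd a (z + (-n - 1) * (2 * Real.pi * Complex.I))
    push_cast at ih ⊢
    rw [show z + (-n - 1) * (2 * Real.pi * Complex.I) + 2 * Real.pi * Complex.I =
      z + -n * (2 * Real.pi * Complex.I) by ring, ih] at this
    linear_combination -this

theorem HasDegree.mul {h k : ℂ ≃ₜ ℂ} {d e : ℤ} (H : HasDegree h d) (K : HasDegree k e) :
    HasDegree (h * k) (d * e) := by
  obtain ⟨L, hL, hLe, hLd⟩ := H
  obtain ⟨M, hM, hMe, hMd⟩ := K
  refine ⟨fun p => L (k p.1, M p), hL.comp ((k.continuous.comp continuous_fst).prodMk hM), ?_, ?_⟩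
  · intro a z
    rw [hLe, hMe, Homeomorph.mul_apply', Homeomorph.mul_apply', add_sub_cancel]
  · intro a z
    simp only
    rw [hMd, HasDegree.add_int_mul hLd]
    push_cast
    ring

theorem hasDegree_one : HasDegree 1 1 :=
  ⟨fun p => p.2, continuous_snd, fun a z => by simp, fun a z => by simp⟩

/-- Complex conjugation as a homeomorphism. -/
noncomputable def conjHomeomorph : ℂ ≃ₜ ℂ := Complex.conjLIE.toHomeomorph

theorem hasDegree_conj : HasDegree conjHomeomorph (-1) := by
  refine ⟨fun p => (starRingEnd ℂ) p.2, Complex.continuous_conj.comp continuous_snd, ?_, ?_⟩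
  · intro a z
    change _ = (starRingEnd ℂ) _ - (starRingEnd ℂ) _
    rw [← map_sub, add_sub_cancel_left, ← Complex.exp_conj]
  · intro a z
    simp [Complex.conj_ofNat]

/-- The degree of a homeomorphism of the plane, as a unit of `ℤ`. -/
noncomputable def degreeHom : (ℂ ≃ₜ ℂ) →* ℤˣ :=
  MonoidHom.toHomUnits
    { toFun := fun h => (exists_hasDegree h).choose
      map_one' := (exists_hasDegree 1).choose_spec.unique hasDegree_one
      map_mul' := fun h k => (exists_hasDegree (h * k)).choose_spec.unique
        ((exists_hasDegree h).choose_spec.mul (exists_hasDegree k).choose_spec) }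

theorem hasDegree_degreeHom (h : ℂ ≃ₜ ℂ) : HasDegree h (degreeHom h) :=
  (exists_hasDegree h).choose_spec

theorem degreeHom_conj : degreeHom conjHomeomorph = -1 := by
  ext
  exact (hasDegree_degreeHom _).unique hasDegree_conj

theorem exists_strictMono_lift_of_norm_eq {P : ℂ ≃ₜ ℂ} (hn : ∀ z, ‖P z‖ = ‖z‖)
    (hd : degreeHom P = 1) :
    ∃ g : ℝ → ℝ, Continuous g ∧ StrictMono g ∧ (∀ y, g (y + 2 * Real.pi) = g y + 2 * Real.pi) ∧
      ∀ y : ℝ, P (Complex.exp (y * Complex.I)) = Complex.exp (g y * Complex.I) := by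
  obtain ⟨L, hL, hLe, hLd⟩ := hasDegree_degreeHom P
  rw [hd] at hLd
  have hP0 : P 0 = 0 := by simpa using hn 0
  have hexp : ∀ y : ℝ, P (Complex.exp (y * Complex.I)) =
      Complex.exp ((L (0, y * Complex.I)).im * Complex.I) := by
    intro y
    have h1 := hLe 0 (y * Complex.I)
    rw [hP0, zero_add, sub_zero] at h1
    have h2 : (L (0, y * Complex.I)).re = 0 := by
      have h3 := congrArg norm h1
      rw [hn, Complex.norm_exp_ofReal_mul_I, Complex.norm_exp, Real.exp_eq_one_iff] at h3
      exact h3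
    rw [← h1]
    congr 1
    apply Complex.ext <;> simp [h2]
  have hper : ∀ y : ℝ, (L (0, ((y + 2 * Real.pi : ℝ) : ℂ) * Complex.I)).im =
      (L (0, y * Complex.I)).im + 2 * Real.pi := by
    intro y
    have h1 := hLd 0 (y * Complex.I)
    rw [show ((y + 2 * Real.pi : ℝ) : ℂ) * Complex.I = y * Complex.I + 2 * Real.pi * Complex.I by
      push_cast; ring, h1]
    simp
  have hc : Continuous fun y : ℝ => (L (0, y * Complex.I)).im :=
    Complex.continuous_im.comp (hL.comp (by fun_prop))
  have hpern : ∀ (y : ℝ) (n : ℤ), (L (0, ((y + n * (2 * Real.pi) : ℝ) : ℂ) * Complex.I)).im =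
      (L (0, y * Complex.I)).im + n * (2 * Real.pi) := by
    intro y n
    have h1 := HasDegree.add_int_mul hLd 0 (y * Complex.I) n
    rw [show ((y + n * (2 * Real.pi) : ℝ) : ℂ) * Complex.I =
      y * Complex.I + n * (2 * Real.pi * Complex.I) by push_cast; ring, h1]
    simp
  have hinj : Function.Injective fun y : ℝ => (L (0, y * Complex.I)).im := by
    intro y y' hy
    simp only at hy
    have h1 : P (Complex.exp (y * Complex.I)) = P (Complex.exp (y' * Complex.I)) := by
      rw [hexp, hexp, hy]
    obtain ⟨n, hn⟩ := Complex.exp_eq_exp_iff_exists_int.1 (P.injective h1)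
    have h2 : y = y' + n * (2 * Real.pi) := by
      have := congrArg Complex.im hn
      simpa using this
    rw [h2, hpern] at hy
    have h3 : (n : ℝ) * (2 * Real.pi) = 0 := by linarith
    rw [h2, h3, add_zero]
  refine ⟨_, hc, ?_, hper, hexp⟩
  rcases hc.strictMono_of_inj hinj with h | h
  · exact h
  · exfalso
    have h1 := h (show (0 : ℝ) < 0 + 2 * Real.pi by positivity)
    simp only at h1
    rw [hper] at h1
    linarith [Real.pi_pos]

theorem add_int_mul_of_add_period {g : ℝ → ℝ} {p : ℝ} (hg : ∀ y, g (y + p) = g y + p) (y : ℝ)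
    (n : ℤ) : g (y + n * p) = g y + n * p := by
  induction n using Int.induction_on with
  | zero => simp
  | succ n ih =>
    have := hg (y + n * p)
    push_cast at ih ⊢
    rw [ih] at this
    rw [show y + (n + 1) * p = y + n * p + p by ring, this]
    ring
  | pred n ih =>
    have := hg (y + (-n - 1) * p)
    push_cast at ih ⊢
    rw [show y + (-n - 1) * p + p = y + -n * p by ring, ih] at this
    linear_combination -this

theorem surjective_of_add_period {g : ℝ → ℝ} {p : ℝ} (hp : 0 < p) (hc : Continuous g)
    (hg : ∀ y, g (y + p) = g y + p) : Function.Surjective g := by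
  intro w
  obtain ⟨n, hn⟩ := exists_int_gt ((w - g 0) / p)
  obtain ⟨m, hm⟩ := exists_int_lt ((w - g 0) / p)
  rw [div_lt_iff₀ hp] at hn
  rw [lt_div_iff₀ hp] at hm
  have h1 := add_int_mul_of_add_period hg 0 n
  have h2 := add_int_mul_of_add_period hg 0 m
  exact mem_range_of_exists_le_of_exists_ge hc ⟨0 + m * p, by linarith⟩ ⟨0 + n * p, by linarith⟩

theorem mem_commutator_of_lift {P : ℂ ≃ₜ ℂ}
    (hr : ∀ (r : ℝ) (z : ℂ), 0 ≤ r → P (r * z) = r * P z) {g : ℝ → ℝ} (hc : Continuous g)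
    (hm : StrictMono g) (hper : ∀ y, g (y + 2 * Real.pi) = g y + 2 * Real.pi)
    (hexp : ∀ y : ℝ, P (Complex.exp (y * Complex.I)) = Complex.exp (g y * Complex.I)) :
    P ∈ commutator (ℂ ≃ₜ ℂ) := by
  set q : ℂ → ℝ := fun z => g z.arg - z.arg with hq
  have hqe : ∀ r y : ℝ, 0 < r → q (r * Complex.exp (y * Complex.I)) = g y - y := by
    intro r y hr
    obtain ⟨n, hn⟩ : ∃ n : ℤ, (r * Complex.exp (y * Complex.I) : ℂ).arg = y + n * (2 * Real.pi) := by
      have h1 := Complex.norm_mul_exp_arg_mul_I (r * Complex.exp (y * Complex.I))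
      rw [norm_mul, Complex.norm_exp_ofReal_mul_I, Complex.norm_real, Real.norm_of_nonneg hr.le,
        mul_one] at h1
      have h2 := mul_left_cancel₀ (Complex.ofReal_ne_zero.2 hr.ne') h1
      obtain ⟨n, hn⟩ := Complex.exp_eq_exp_iff_exists_int.1 h2
      exact ⟨n, by simpa using congrArg Complex.im hn⟩
    simp only [hq]
    rw [hn, add_int_mul_of_add_period hper]
    ring
  have hpol : ∀ z : ℂ, z = ‖z‖ * Complex.exp (z.arg * Complex.I) := fun z =>
    (Complex.norm_mul_exp_arg_mul_I z).symm
  have hqc : ∀ z0 : ℂ, z0 ≠ 0 → ContinuousAt q z0 := by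
    intro z0 hz0
    have h1 : ContinuousAt (fun z : ℂ => z0.arg + (Complex.log (z / z0)).im) z0 := by
      refine continuousAt_const.add (Complex.continuous_im.continuousAt.comp ?_)
      refine ContinuousAt.clog (by fun_prop) ?_
      rw [div_self hz0]
      exact Complex.one_mem_slitPlane
    have h2 : ContinuousAt (fun z : ℂ => g (z0.arg + (Complex.log (z / z0)).im) -
        (z0.arg + (Complex.log (z / z0)).im)) z0 :=
      (ContinuousAt.comp (f := fun z : ℂ => z0.arg + (Complex.log (z / z0)).im)
        hc.continuousAt h1).sub h1
    refine h2.congr ?_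
    filter_upwards [isOpen_ne.mem_nhds hz0] with z hz
    rw [← hqe ‖z‖ _ (norm_pos_iff.2 hz)]
    congr 1
    rw [Complex.log_im]
    have h3 : (‖z0‖ : ℂ) * Complex.exp (z0.arg * Complex.I) *
        (‖z / z0‖ * Complex.exp ((z / z0).arg * Complex.I)) = z := by
      rw [← hpol, ← hpol, mul_div_cancel₀ z hz0]
    have h4 : (‖z‖ : ℂ) = ‖z0‖ * ‖z / z0‖ := by
      rw [norm_div]
      push_cast
      rw [mul_div_cancel₀ _ (Complex.ofReal_ne_zero.2 (norm_pos_iff.2 hz0).ne')]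
    rw [h4, Complex.ofReal_add, add_mul, Complex.exp_add]
    refine Eq.trans ?_ h3
    ring
  set t : ℝ → ℝ := fun r => max 0 (min 1 (r - 1)) with ht
  have ht0 : ∀ r, 0 ≤ t r := fun r => le_max_left _ _
  have ht1 : ∀ r, t r ≤ 1 := fun r => max_le zero_le_one (min_le_left _ _)
  have htc : Continuous t := by fun_prop
  have hts : ∀ r, r ≤ 1 → t r = 0 := fun r hr =>
    max_eq_left ((min_le_right _ _).trans (by linarith))
  have htb : ∀ r, 2 ≤ r → t r = 1 := fun r hr => by
    simp only [ht]
    rw [min_eq_left (by linarith), max_eq_right zero_le_one]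
  set Q : ℂ → ℂ := fun z => z * Complex.exp ((t ‖z‖ * q z : ℝ) * Complex.I) with hQ
  have hQn : ∀ z, ‖Q z‖ = ‖z‖ := fun z => by
    simp only [hQ]
    rw [norm_mul, Complex.norm_exp_ofReal_mul_I, mul_one]
  have hQs : ∀ z, ‖z‖ ≤ 1 → Q z = z := fun z hz => by simp [hQ, hts _ hz]
  have hQ0 : Q 0 = 0 := by simp [hQ]
  have hQe : ∀ r y : ℝ, 0 < r → Q (r * Complex.exp (y * Complex.I)) =
      r * Complex.exp ((y + t r * (g y - y) : ℝ) * Complex.I) := by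
    intro r y hr
    simp only [hQ]
    rw [hqe r y hr, norm_mul, Complex.norm_exp_ofReal_mul_I, Complex.norm_real,
      Real.norm_of_nonneg hr.le, mul_one, mul_assoc, ← Complex.exp_add]
    push_cast
    ring_nf
  have hGm : ∀ r, StrictMono fun y => y + t r * (g y - y) := by
    intro r y y' hy
    have h1 := hm hy
    simp only
    rcases (ht0 r).eq_or_lt with h2 | h2
    · rw [← h2]
      linarith
    · nlinarith [ht1 r]
  have hGp : ∀ r y, (y + 2 * Real.pi) + t r * (g (y + 2 * Real.pi) - (y + 2 * Real.pi)) =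
      (y + t r * (g y - y)) + 2 * Real.pi := by
    intro r y
    rw [hper]
    ring
  have hQc : Continuous Q := by
    rw [continuous_iff_continuousAt]
    intro z
    by_cases hz : z = 0
    · rw [hz]
      refine (continuousAt_id (x := (0 : ℂ))).congr ?_
      filter_upwards [ball_mem_nhds (0 : ℂ) one_pos] with w hw
      exact (hQs w (by simpa using (mem_ball_zero_iff.1 hw).le)).symm
    · have h1 := hqc z hz
      simp only [hQ]
      have h2 : ContinuousAt (fun z : ℂ => t ‖z‖) z := (htc.comp continuous_norm).continuousAt
      refine continuousAt_id.mul (ContinuousAt.cexp (ContinuousAt.mul ?_ continuousAt_const))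
      exact Complex.continuous_ofReal.continuousAt.comp (h2.mul h1)
  have hQb : Function.Bijective Q := by
    constructor
    · intro z z' hzz
      have h1 : ‖z‖ = ‖z'‖ := by rw [← hQn z, hzz, hQn]
      by_cases hz : z = 0
      · rw [hz, norm_zero] at h1
        rw [hz, norm_eq_zero.1 h1.symm]
      · have hz0 := norm_pos_iff.2 hz
        rw [hpol z, hpol z', ← h1, hQe _ _ hz0, hQe _ _ hz0] at hzz
        have h2 := mul_left_cancel₀ (Complex.ofReal_ne_zero.2 hz0.ne') hzz
        obtain ⟨n, hn⟩ := Complex.exp_eq_exp_iff_exists_int.1 h2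
        have h3 : z.arg + t ‖z‖ * (g z.arg - z.arg) =
            (z'.arg + t ‖z‖ * (g z'.arg - z'.arg)) + n * (2 * Real.pi) := by
          simpa using congrArg Complex.im hn
        have h4 := (hGm ‖z‖).injective (h3.trans (add_int_mul_of_add_period
          (g := fun y => y + t ‖z‖ * (g y - y)) (hGp ‖z‖) z'.arg n).symm)
        rw [hpol z, hpol z', ← h1, h4]
        congr 1
        rw [Complex.exp_eq_exp_iff_exists_int]
        exact ⟨n, by push_cast; ring⟩
    · intro w
      by_cases hw : w = 0
      · exact ⟨0, by rw [hQ0, hw]⟩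
      · obtain ⟨y, hy⟩ := surjective_of_add_period Real.two_pi_pos
          (g := fun y => y + t ‖w‖ * (g y - y)) (by fun_prop) (hGp ‖w‖) w.arg
        refine ⟨‖w‖ * Complex.exp (y * Complex.I), ?_⟩
        simp only at hy
        rw [hQe _ _ (norm_pos_iff.2 hw), hy, ← hpol]
  obtain ⟨k, hk⟩ := exists_homeomorph_of_bijective hQc hQb
    (by simpa only [hQn] using tendsto_norm_cocompact_atTop)
  have hk1 : k ∈ commutator (ℂ ≃ₜ ℂ) := by
    refine mem_commutator_of_eq_id_on_ball (c := 0) one_pos fun x hx => ?_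
    rw [hk, hQs x (mem_ball_zero_iff.1 hx).le]
  refine mem_commutator_of_eqOn_open hk1 (U := {z : ℂ | 2 < ‖z‖})
    (isOpen_lt continuous_const continuous_norm) ⟨3, by norm_num⟩ fun z hz => ?_
  have hz : 2 < ‖z‖ := hz
  rw [hk, hpol z, hQe _ _ (by linarith), htb _ hz.le, hr _ _ (norm_nonneg z), hexp]
  ring_nf

theorem mem_commutator_of_cone {P : ℂ ≃ₜ ℂ} (hn : ∀ z, ‖P z‖ = ‖z‖)
    (hr : ∀ (r : ℝ) (z : ℂ), 0 ≤ r → P (r * z) = r * P z) (hd : degreeHom P = 1) :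
    P ∈ commutator (ℂ ≃ₜ ℂ) := by
  obtain ⟨g, hc, hm, hper, hexp⟩ := exists_strictMono_lift_of_norm_eq hn hd
  exact mem_commutator_of_lift hr hc hm hper hexp

/-- A weak form of Montel's theorem. -/
theorem exists_tendstoLocallyUniformlyOn_hyperfilter {U : Set ℂ} (hU : IsOpen U) {f : ℕ → ℂ → ℂ}
    (hf : ∀ n, DifferentiableOn ℂ (f n) U) (hm : ∀ n, MapsTo (f n) U (ball 0 1)) :
    ∃ g, TendstoLocallyUniformlyOn f g (hyperfilter ℕ) U := by
  have hlim : ∀ z, ∃ w, z ∈ U → Tendsto (fun n => f n z) (hyperfilter ℕ) (𝓝 w) := by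
    intro z
    by_cases hz : z ∈ U
    · obtain ⟨w, -, hw⟩ := (isCompact_closedBall (0 : ℂ) 1).ultrafilter_le_nhds
        ((hyperfilter ℕ).map fun n => f n z) (by
          rw [Ultrafilter.coe_map, le_principal_iff, mem_map]
          exact univ_mem' fun n => ball_subset_closedBall (hm n hz))
      exact ⟨w, fun _ => hw⟩
    · exact ⟨0, fun h => absurd h hz⟩
  choose g hg using hlim
  refine ⟨g, ?_⟩
  rw [Metric.tendstoLocallyUniformlyOn_iff]
  intro ε hε z hz
  obtain ⟨r, hr, hrU⟩ := Metric.isOpen_iff.1 hU z hz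
  have hlip : ∀ n, ∀ w ∈ ball z r, dist (f n w) (f n z) ≤ 2 / r * dist w z := by
    intro n w hw
    refine Complex.dist_le_div_mul_dist_of_mapsTo_ball ((hf n).mono hrU) ?_ hw
    intro v hv
    have h1 := mem_ball_zero_iff.1 (hm n (hrU hv))
    have h2 := mem_ball_zero_iff.1 (hm n hz)
    rw [mem_closedBall, dist_eq_norm]
    linarith [norm_sub_le (f n v) (f n z)]
  have hδ : 0 < min r (ε / 4 / (2 / r)) := by positivity
  refine ⟨ball z (min r (ε / 4 / (2 / r))), mem_nhdsWithin_of_mem_nhds (ball_mem_nhds z hδ), ?_⟩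
  have hn : ∀ n, ∀ w ∈ ball z (min r (ε / 4 / (2 / r))), dist (f n w) (f n z) ≤ ε / 4 := by
    intro n w hw
    rw [mem_ball, lt_min_iff] at hw
    refine (hlip n w hw.1).trans ?_
    have := mul_lt_mul_of_pos_left hw.2 (show 0 < 2 / r by positivity)
    rw [mul_div_cancel₀ _ (by positivity)] at this
    exact this.le
  have hz' := Metric.tendsto_nhds.1 (hg z hz) (ε / 4) (by positivity)
  filter_upwards [hz'] with n hnz w hw
  have hwU : w ∈ U := hrU (ball_subset_ball (min_le_left _ _) hw)
  have hgw : dist (g w) (g z) ≤ ε / 4 :=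
    le_of_tendsto ((hg w hwU).dist (hg z hz)) (univ_mem' fun m => hn m w hw)
  have h1 := hn n w hw
  have h2 := dist_triangle4 (g w) (g z) (f n z) (f n w)
  rw [dist_comm (g z), dist_comm (f n z) (f n w)] at h2
  linarith

/-- Hurwitz's theorem: isolated zeros of a locally uniform limit are limits of zeros. -/
theorem eventually_exists_zero_of_tendstoLocallyUniformlyOn {ι : Type*} {l : Filter ι} [l.NeBot]
    {U : Set ℂ} (hU : IsOpen U) {f : ι → ℂ → ℂ} {g : ℂ → ℂ}
    (hf : ∀ n, DifferentiableOn ℂ (f n) U) (hfg : TendstoLocallyUniformlyOn f g l U) {z₀ : ℂ}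
    (hz₀ : z₀ ∈ U) (hg : g z₀ = 0) (hne : ¬ ∀ᶠ z in 𝓝 z₀, g z = 0) :
    ∀ᶠ n in l, ∃ z ∈ U, f n z = 0 := by
  have hgd : DifferentiableOn ℂ g U := hfg.differentiableOn (univ_mem' hf) hU
  have hiso := (hgd.analyticOnNhd hU z₀ hz₀).eventually_eq_zero_or_eventually_ne_zero.resolve_left
    hne
  rw [eventually_nhdsWithin_iff] at hiso
  obtain ⟨r, hr, hrs⟩ := nhds_basis_closedBall.mem_iff.1 (inter_mem hiso (hU.mem_nhds hz₀))
  have hrU : closedBall z₀ r ⊆ U := fun z hz => (hrs hz).2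
  obtain ⟨z₁, hz₁, hmin⟩ := (isCompact_sphere z₀ r).exists_isMinOn
    (NormedSpace.sphere_nonempty.2 hr.le)
    ((hgd.continuousOn.mono (sphere_subset_closedBall.trans hrU)).norm)
  set m := ‖g z₁‖ with hm
  have hm0 : 0 < m := norm_pos_iff.2 ((hrs (sphere_subset_closedBall hz₁)).1
    (ne_of_mem_sphere hz₁ hr.ne'))
  have hunif := (tendstoLocallyUniformlyOn_iff_forall_isCompact hU).1 hfg _ hrU
    (isCompact_closedBall _ _)
  filter_upwards [Metric.tendstoUniformlyOn_iff.1 hunif (m / 8) (by positivity)] with n hn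
  have h0 := hn z₀ (mem_closedBall_self hr.le)
  rw [hg, dist_zero_left] at h0
  have hsph : ∀ z ∈ sphere z₀ r, m / 2 ≤ ‖f n z - f n z₀‖ := by
    intro z hz
    have h1 := hn z (sphere_subset_closedBall hz)
    have h2 : m ≤ ‖g z‖ := hmin hz
    rw [dist_eq_norm] at h1
    have h3 : ‖g z‖ ≤ ‖g z - f n z‖ + ‖f n z - f n z₀‖ + ‖f n z₀‖ := by
      have := norm_add₃_le (a := g z - f n z) (b := f n z - f n z₀) (c := f n z₀)
      rwa [sub_add_sub_cancel, sub_add_cancel] at this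
    linarith
  have hfr : ∃ᶠ z in 𝓝 z₀, f n z ≠ f n z₀ := by
    intro hcon
    simp only [not_not] at hcon
    have h4 := ((hf n).analyticOnNhd hU).mono hrU
    have h5 := h4.eqOn_of_preconnected_of_eventuallyEq analyticOnNhd_const
      (convex_closedBall z₀ r).isPreconnected (mem_closedBall_self hr.le) hcon
    have h6 := hsph z₁ hz₁
    rw [h5 (sphere_subset_closedBall hz₁), sub_self, norm_zero] at h6
    linarith
  have hsub := ((hf n).diffContOnCl_ball hrU).ball_subset_image_closedBall hr hsph hfr
  obtain ⟨z, hz, hz'⟩ := hsub (show (0 : ℂ) ∈ ball (f n z₀) (m / 2 / 2) by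
    rw [mem_ball, dist_zero_left]
    linarith)
  exact ⟨z, hrU hz, hz'⟩

theorem injOn_and_deriv_ne_zero_of_tendstoLocallyUniformlyOn {ι : Type*} {l : Filter ι} [l.NeBot]
    {U : Set ℂ} (hU : IsOpen U) (hUc : IsPreconnected U) {f : ι → ℂ → ℂ} {g : ℂ → ℂ}
    (hf : ∀ n, DifferentiableOn ℂ (f n) U) (hfg : TendstoLocallyUniformlyOn f g l U)
    (hinj : ∀ n, InjOn (f n) U) (hd : ∀ n, ∀ z ∈ U, deriv (f n) z ≠ 0) {p : ℂ} (hp : p ∈ U)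
    (hgp : deriv g p ≠ 0) : InjOn g U ∧ ∀ z ∈ U, deriv g z ≠ 0 := by
  have hgd : DifferentiableOn ℂ g U := hfg.differentiableOn (univ_mem' hf) hU
  constructor
  · intro a ha b hb hab
    by_contra hne
    have h1 : TendstoLocallyUniformlyOn (fun n z => f n z - f n b) (fun z => g z - g b) l
        (U \ {b}) := by
      have h2 := hfg.tendsto_at hb
      rw [Metric.tendsto_nhds] at h2
      rw [Metric.tendstoLocallyUniformlyOn_iff] at hfg ⊢
      intro ε hε z hz
      obtain ⟨t, ht, hn⟩ := hfg (ε / 2) (by positivity) z hz.1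
      refine ⟨t, nhdsWithin_mono _ sdiff_subset ht, ?_⟩
      filter_upwards [hn, h2 (ε / 2) (by positivity)] with n hn hnb y hy
      have h4 := hn y hy
      have h5 := dist_sub_sub_le (g y) (g b) (f n y) (f n b)
      rw [dist_comm (g b)] at h5
      linarith
    have h3 := eventually_exists_zero_of_tendstoLocallyUniformlyOn (hU.sdiff isClosed_singleton)
      (fun n => ((hf n).mono sdiff_subset).sub_const _) h1 (z₀ := a) ⟨ha, hne⟩ (sub_eq_zero.2 hab)
      (by
        intro hcon
        have h4 : g =ᶠ[𝓝 a] fun _ => g b := hcon.mono fun z hz => sub_eq_zero.1 hz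
        have h5 := (hgd.analyticOnNhd hU).eqOn_of_preconnected_of_eventuallyEq
          analyticOnNhd_const hUc ha h4
        exact hgp (((h5.eventuallyEq_of_mem (hU.mem_nhds hp)).deriv_eq).trans (deriv_const _ _)))
    obtain ⟨n, z, hz, hzb⟩ := h3.exists
    exact hz.2 (hinj n hz.1 hb (sub_eq_zero.1 hzb))
  · intro z hz hcon
    have h1 := hfg.deriv (univ_mem' hf) hU
    have h2 := eventually_exists_zero_of_tendstoLocallyUniformlyOn hU
      (fun n => (hf n).deriv hU) h1 hz hcon (by
        intro hc
        have h5 := ((hgd.deriv hU).analyticOnNhd hU).eqOn_of_preconnected_of_eventuallyEq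
          analyticOnNhd_const hUc hz hc
        exact hgp (h5 hp))
    obtain ⟨n, w, hw, hw0⟩ := h2.exists
    exact hd n w hw hw0

/-- The automorphism of the unit disk exchanging `a` and `0`, up to sign. -/
noncomputable def diskAut (a z : ℂ) : ℂ := (z - a) / (1 - (starRingEnd ℂ) a * z)

theorem one_sub_conj_mul_ne_zero {a z : ℂ} (ha : ‖a‖ < 1) (hz : ‖z‖ < 1) :
    1 - (starRingEnd ℂ) a * z ≠ 0 := by
  intro h
  have h1 : ‖(starRingEnd ℂ) a * z‖ = 1 := by rw [← sub_eq_zero.1 h, norm_one]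
  rw [norm_mul, RCLike.norm_conj] at h1
  nlinarith [norm_nonneg a, norm_nonneg z]

theorem norm_diskAut_lt_one {a z : ℂ} (ha : ‖a‖ < 1) (hz : ‖z‖ < 1) : ‖diskAut a z‖ < 1 := by
  rw [diskAut, norm_div, div_lt_one (norm_pos_iff.2 (one_sub_conj_mul_ne_zero ha hz))]
  refine lt_of_pow_lt_pow_left₀ 2 (norm_nonneg _) ?_
  have h1 : ‖a‖ ^ 2 < 1 := by nlinarith [norm_nonneg a]
  have h2 : ‖z‖ ^ 2 < 1 := by nlinarith [norm_nonneg z]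
  have h3 := mul_pos (sub_pos.2 h1) (sub_pos.2 h2)
  simp only [← Complex.normSq_eq_norm_sq, Complex.normSq_apply, Complex.sub_re, Complex.sub_im,
    Complex.mul_re, Complex.mul_im, Complex.conj_re, Complex.conj_im, Complex.one_re,
    Complex.one_im] at h3 ⊢
  nlinarith [h3]

theorem hasDerivAt_diskAut {a z : ℂ} (ha : ‖a‖ < 1) (hz : ‖z‖ < 1) :
    HasDerivAt (diskAut a) ((1 - ‖a‖ ^ 2) / (1 - (starRingEnd ℂ) a * z) ^ 2) z := by
  have h1 := one_sub_conj_mul_ne_zero ha hz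
  have h2 := ((hasDerivAt_id z).sub_const a).div
    (((hasDerivAt_id z).const_mul ((starRingEnd ℂ) a)).const_sub 1) h1
  refine h2.congr_deriv ?_
  rw [← Complex.conj_mul' a]
  simp only [id]
  ring

theorem diskAut_injective_on {a z w : ℂ} (ha : ‖a‖ < 1) (hz : ‖z‖ < 1) (hw : ‖w‖ < 1)
    (h : diskAut a z = diskAut a w) : z = w := by
  have h1 := one_sub_conj_mul_ne_zero ha hz
  have h2 := one_sub_conj_mul_ne_zero ha hw
  rw [diskAut, diskAut, div_eq_div_iff h1 h2] at h
  have h3 : (z - w) * (1 - (starRingEnd ℂ) a * a) = 0 := by linear_combination h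
  rcases mul_eq_zero.1 h3 with h4 | h4
  · exact sub_eq_zero.1 h4
  · exact absurd h4 (one_sub_conj_mul_ne_zero ha ha)

/-- The square root step in the proof of the Riemann mapping theorem. -/
theorem exists_norm_deriv_gt_of_notMem_image {U : Set ℂ} (hU : IsOpen U)
    (hUc : IsSimplyConnected U) {p : ℂ} (hp : p ∈ U) {f : ℂ → ℂ} (hf : DifferentiableOn ℂ f U)
    (hm : MapsTo f U (ball 0 1)) (hi : InjOn f U) (hd : ∀ z ∈ U, deriv f z ≠ 0) (hfp : f p = 0)
    {a : ℂ} (ha : ‖a‖ < 1) (haf : a ∉ f '' U) :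
    ∃ g : ℂ → ℂ, DifferentiableOn ℂ g U ∧ MapsTo g U (ball 0 1) ∧ InjOn g U ∧
      (∀ z ∈ U, deriv g z ≠ 0) ∧ g p = 0 ∧ ‖deriv f p‖ < ‖deriv g p‖ := by
  have hm' : ∀ z ∈ U, ‖f z‖ < 1 := fun z hz => mem_ball_zero_iff.1 (hm hz)
  set F : ℂ → ℂ := fun z => diskAut a (f z) with hF
  have hFd : ∀ z ∈ U, HasDerivAt F
      ((1 - ‖a‖ ^ 2) / (1 - (starRingEnd ℂ) a * f z) ^ 2 * deriv f z) z := fun z hz =>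
    (hasDerivAt_diskAut ha (hm' z hz)).comp z (hf.differentiableAt (hU.mem_nhds hz)).hasDerivAt
  have hF0 : ∀ z ∈ U, F z ≠ 0 := by
    intro z hz h0
    refine haf ⟨z, hz, ?_⟩
    simp only [hF, diskAut] at h0
    rw [div_eq_zero_iff, sub_eq_zero] at h0
    exact h0.resolve_right (one_sub_conj_mul_ne_zero ha (hm' z hz))
  have hFn : ∀ z ∈ U, ‖F z‖ < 1 := fun z hz => norm_diskAut_lt_one ha (hm' z hz)
  obtain ⟨s, hsc, hs⟩ := Complex.exists_continuousOn_pow_eq hUc hU (g := F)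
    (fun z hz => (hFd z hz).continuousAt.continuousWithinAt)
    (by rintro ⟨z, hz, h0⟩; exact hF0 z hz h0) two_ne_zero
  have hs0 : ∀ z ∈ U, s z ≠ 0 := by
    intro z hz h0
    apply hF0 z hz
    rw [← hs z, h0]
    norm_num
  have hsn : ∀ z ∈ U, ‖s z‖ < 1 := by
    intro z hz
    have h1 := hFn z hz
    rw [← hs z, norm_pow] at h1
    exact (pow_lt_one_iff_of_nonneg (norm_nonneg _) two_ne_zero).1 h1
  have hone : (1 - ‖a‖ ^ 2 : ℂ) ≠ 0 := by
    rw [← Complex.conj_mul' a]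
    exact one_sub_conj_mul_ne_zero ha ha
  have hsd : ∀ z ∈ U, HasDerivAt s ((2 * s z)⁻¹ *
      ((1 - ‖a‖ ^ 2) / (1 - (starRingEnd ℂ) a * f z) ^ 2 * deriv f z)) z := by
    intro z hz
    have hpow : HasStrictDerivAt (fun w : ℂ => w ^ 2) (2 * s z) (s z) := by
      simpa using hasStrictDerivAt_pow 2 (s z)
    have h2 : (2 * s z) ≠ 0 := mul_ne_zero two_ne_zero (hs0 z hz)
    have h3 : ContinuousAt s z := hsc.continuousAt (hU.mem_nhds hz)
    have h4 := (hpow.to_localInverse h2)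
    have h5 := hpow.eventually_left_inverse h2
    have h6 := (h4.hasDerivAt)
    rw [hs z] at h6
    have h7 := h6.comp z (hFd z hz)
    refine h7.congr_of_eventuallyEq ?_
    filter_upwards [h3.eventually h5] with w hw
    rw [Function.comp_apply, ← hs w]
    exact hw.symm
  set b := s p with hb
  have hbn : ‖b‖ < 1 := hsn p hp
  have hb0 : b ≠ 0 := hs0 p hp
  have hgd : ∀ z ∈ U, HasDerivAt (fun z => diskAut b (s z))
      ((1 - ‖b‖ ^ 2) / (1 - (starRingEnd ℂ) b * s z) ^ 2 * ((2 * s z)⁻¹ *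
      ((1 - ‖a‖ ^ 2) / (1 - (starRingEnd ℂ) a * f z) ^ 2 * deriv f z))) z := fun z hz =>
    (hasDerivAt_diskAut hbn (hsn z hz)).comp z (hsd z hz)
  have honeb : (1 - ‖b‖ ^ 2 : ℂ) ≠ 0 := by
    rw [← Complex.conj_mul' b]
    exact one_sub_conj_mul_ne_zero hbn hbn
  refine ⟨fun z => diskAut b (s z), fun z hz => (hgd z hz).differentiableAt.differentiableWithinAt,
    fun z hz => mem_ball_zero_iff.2 (norm_diskAut_lt_one hbn (hsn z hz)), ?_, ?_, ?_, ?_⟩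
  · intro z hz w hw hzw
    have h1 := diskAut_injective_on hbn (hsn z hz) (hsn w hw) hzw
    have h2 : F z = F w := by rw [← hs, ← hs, h1]
    exact hi hz hw (diskAut_injective_on ha (hm' z hz) (hm' w hw) h2)
  · intro z hz
    rw [(hgd z hz).deriv]
    have h1 := one_sub_conj_mul_ne_zero ha (hm' z hz)
    have h2 := one_sub_conj_mul_ne_zero hbn (hsn z hz)
    exact mul_ne_zero (div_ne_zero honeb (pow_ne_zero _ h2)) (mul_ne_zero
      (inv_ne_zero (mul_ne_zero two_ne_zero (hs0 z hz)))
      (mul_ne_zero (div_ne_zero hone (pow_ne_zero _ h1)) (hd z hz)))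
  · simp [diskAut, hb]
  · rw [(hgd p hp).deriv, hfp, ← hb, mul_zero, sub_zero, Complex.conj_mul' b]
    have hab : ‖a‖ = ‖b‖ ^ 2 := by
      rw [← norm_pow, hb, hs p]
      simp [hF, hfp, diskAut]
    have hbp : 0 < ‖b‖ := norm_pos_iff.2 hb0
    have hbp1 : 0 < 1 - ‖b‖ ^ 2 := by nlinarith
    have hc : ∀ x : ℝ, ‖(1 - (x : ℂ) ^ 2)‖ = |1 - x ^ 2| := fun x => by
      rw [← Real.norm_eq_abs, ← Complex.norm_real]
      push_cast
      rfl
    have hd0 := norm_pos_iff.2 (hd p hp)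
    simp only [norm_mul, norm_div, norm_inv, norm_pow, hc, Complex.norm_ofNat, norm_one]
    rw [hab, abs_of_pos hbp1, abs_of_pos (by nlinarith : 0 < 1 - (‖b‖ ^ 2) ^ 2)]
    have : (1 - ‖b‖ ^ 2) / (1 - ‖b‖ ^ 2) ^ 2 *
        ((2 * ‖b‖)⁻¹ * ((1 - (‖b‖ ^ 2) ^ 2) / 1 ^ 2 * ‖deriv f p‖)) =
        (1 + ‖b‖ ^ 2) / (2 * ‖b‖) * ‖deriv f p‖ := by
      field_simp
      ring
    rw [this]
    have h9 : 1 < (1 + ‖b‖ ^ 2) / (2 * ‖b‖) := by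
      rw [one_lt_div (by positivity)]
      nlinarith
    nlinarith

/-- The Riemann mapping theorem for bounded domains. -/
theorem exists_biholomorphic_to_ball {U : Set ℂ} (hU : IsOpen U) (hUc : IsSimplyConnected U)
    (hb : Bornology.IsBounded U) : ∃ f : ℂ → ℂ, DifferentiableOn ℂ f U ∧ InjOn f U ∧
      (∀ z ∈ U, deriv f z ≠ 0) ∧ f '' U = ball 0 1 := by
  obtain ⟨p, hp⟩ := hUc.nonempty
  have hpre : IsPreconnected U := hUc.isPathConnected.isConnected.isPreconnected
  set S : Set (ℂ → ℂ) := {f | DifferentiableOn ℂ f U ∧ MapsTo f U (ball 0 1) ∧ InjOn f U ∧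
    (∀ z ∈ U, deriv f z ≠ 0) ∧ f p = 0} with hS
  obtain ⟨R, hR, hUR⟩ : ∃ R : ℝ, 0 < R ∧ U ⊆ ball p R := by
    obtain ⟨R, hR⟩ := (Metric.isBounded_iff_subset_ball p).1 hb
    exact ⟨max R 1, by positivity, hR.trans (ball_subset_ball (le_max_left _ _))⟩
  have hR' : (R : ℂ) ≠ 0 := Complex.ofReal_ne_zero.2 hR.ne'
  have hf0 : (fun z => (z - p) / R) ∈ S := by
    have hder : ∀ z : ℂ, HasDerivAt (fun z : ℂ => (z - p) / R) (1 / R) z := fun z =>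
      ((hasDerivAt_id z).sub_const p).div_const _
    refine ⟨fun z _ => (hder z).differentiableAt.differentiableWithinAt, fun z hz => ?_, ?_, ?_, ?_⟩
    · rw [mem_ball_zero_iff, norm_div, Complex.norm_real, Real.norm_of_nonneg hR.le,
        div_lt_one hR, ← dist_eq_norm]
      exact hUR hz
    · intro z _ w _ h
      simpa [div_left_inj' hR'] using h
    · intro z _
      rw [(hder z).deriv]
      exact one_div_ne_zero hR'
    · simp
  obtain ⟨r, hr, hrU⟩ := Metric.isOpen_iff.1 hU p hp
  have hbdd : BddAbove ((fun f : ℂ → ℂ => ‖deriv f p‖) '' S) := by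
    refine ⟨1 / r, ?_⟩
    rintro _ ⟨f, ⟨hfd, hfm, -, -, hfp⟩, rfl⟩
    refine Complex.norm_deriv_le_div_of_mapsTo_ball (hfd.mono hrU) ?_ hr
    rw [hfp]
    exact (hfm.mono_left hrU).mono_right ball_subset_closedBall
  obtain ⟨u, -, hu, huS⟩ := exists_seq_tendsto_sSup ⟨_, mem_image_of_mem _ hf0⟩ hbdd
  choose f hfS hfu using huS
  obtain ⟨g, hg⟩ := exists_tendstoLocallyUniformlyOn_hyperfilter hU (fun n => (hfS n).1)
    (fun n => (hfS n).2.1)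
  have hgd : DifferentiableOn ℂ g U := hg.differentiableOn (univ_mem' fun n => (hfS n).1) hU
  have hder : ‖deriv g p‖ = sSup ((fun f : ℂ → ℂ => ‖deriv f p‖) '' S) := by
    have h1 := ((hg.deriv (univ_mem' fun n => (hfS n).1) hU).tendsto_at hp).norm
    refine tendsto_nhds_unique h1 ((hu.mono_left Nat.hyperfilter_le_atTop).congr fun n => ?_)
    exact (hfu n).symm
  have hle : ∀ k ∈ S, ‖deriv k p‖ ≤ ‖deriv g p‖ := fun k hk => by
    rw [hder]
    exact le_csSup hbdd (mem_image_of_mem _ hk)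
  have hgp : deriv g p ≠ 0 := by
    have h1 := hle _ hf0
    have h2 := norm_pos_iff.2 (hf0.2.2.2.1 p hp)
    exact norm_pos_iff.1 (h2.trans_le h1)
  obtain ⟨hgi, hg0⟩ := injOn_and_deriv_ne_zero_of_tendstoLocallyUniformlyOn hU hpre
    (fun n => (hfS n).1) hg (fun n => (hfS n).2.2.1) (fun n => (hfS n).2.2.2.1) hp hgp
  have hgpz : g p = 0 := by
    refine tendsto_nhds_unique (hg.tendsto_at hp) ?_
    simp only [(hfS _).2.2.2.2]
    exact tendsto_const_nhds
  have hgm : MapsTo g U (ball 0 1) := by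
    have h1 : g '' U ⊆ closedBall 0 1 := by
      rintro _ ⟨z, hz, rfl⟩
      exact isClosed_closedBall.mem_of_tendsto (hg.tendsto_at hz)
        (univ_mem' fun n => ball_subset_closedBall ((hfS n).2.1 hz))
    have h2 : IsOpen (g '' U) := by
      refine ((hgd.analyticOnNhd hU).is_constant_or_isOpen hpre).resolve_left ?_ U subset_rfl hU
      rintro ⟨w, hw⟩
      have h3 : g =ᶠ[𝓝 p] fun _ => w := eventually_of_mem (hU.mem_nhds hp) hw
      exact hgp (h3.deriv_eq.trans (deriv_const _ _))
    rw [mapsTo_iff_image_subset, ← interior_closedBall _ one_ne_zero]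
    exact interior_maximal h1 h2
  refine ⟨g, hgd, hgi, hg0, subset_antisymm (mapsTo_iff_image_subset.1 hgm) fun a ha => ?_⟩
  by_contra hna
  obtain ⟨k, h1, h2, h3, h4, h5, h6⟩ := exists_norm_deriv_gt_of_notMem_image hU hUc hp hgd hgm hgi
    hg0 hgpz (mem_ball_zero_iff.1 ha) hna
  exact h6.not_ge (hle k ⟨h1, h2, h3, h4, h5⟩)

section Crosscuts

open MeasureTheory

theorem det_restrictScalars_toSpanSingleton (c : ℂ) :
    ((ContinuousLinearMap.toSpanSingleton ℂ c).restrictScalars ℝ).det = ‖c‖ ^ 2 := by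
  have := Algebra.norm_complex_apply c
  rw [Algebra.norm_apply] at this
  rw [← Complex.normSq_eq_norm_sq, ← this, ContinuousLinearMap.det]
  congr 1
  ext
  simp [mul_comm]

theorem volume_image_eq_lintegral_norm_deriv_sq {U : Set ℂ} (hU : IsOpen U) {f : ℂ → ℂ}
    (hf : DifferentiableOn ℂ f U) (hi : InjOn f U) :
    volume (f '' U) = ∫⁻ z in U, ENNReal.ofReal (‖deriv f z‖ ^ 2) := by
  have h := lintegral_image_eq_lintegral_abs_det_fderiv_mul volume hU.measurableSet
    (f' := fun z => (ContinuousLinearMap.toSpanSingleton ℂ (deriv f z)).restrictScalars ℝ)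
    (fun z hz => (((hf.differentiableAt (hU.mem_nhds hz)).hasDerivAt.hasFDerivAt).restrictScalars
      ℝ).hasFDerivWithinAt) hi 1
  simpa [det_restrictScalars_toSpanSingleton] using h

theorem polar_mem_ball_one_iff {r θ : ℝ} (hr : 0 < r) :
    (r * (Real.cos θ + Real.sin θ * Complex.I) : ℂ) ∈ ball 1 1 ↔ r / 2 < Real.cos θ := by
  rw [mem_ball, dist_eq_norm, ← sq_lt_one_iff₀ (norm_nonneg _), ← Complex.normSq_eq_norm_sq,
    Complex.normSq_apply]
  simp only [Complex.sub_re, Complex.sub_im, Complex.mul_re, Complex.mul_im, Complex.add_re,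
    Complex.add_im, Complex.ofReal_re, Complex.ofReal_im, Complex.I_re, Complex.I_im,
    Complex.one_re, Complex.one_im]
  have := Real.sin_sq_add_cos_sq θ
  constructor
  · intro h
    have : r * (r / 2) < r * Real.cos θ := by nlinarith
    exact lt_of_mul_lt_mul_left this hr.le
  · intro h
    have := mul_lt_mul_of_pos_left h hr
    nlinarith

/-- A lower bound for the energy of a holomorphic function on a circular arc in terms of the
oscillation of the function on this arc. -/
theorem le_lintegral_arc {ψ : ℂ → ℂ} (hd : DifferentiableOn ℂ ψ (ball 1 1)) {r ε : ℝ} (hr : 0 < r)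
    (hε : 0 < ε) {w₁ w₂ : ℂ} (h₁ : w₁ ∈ ball (1 : ℂ) 1) (h₂ : w₂ ∈ ball (1 : ℂ) 1) (hw₁ : ‖w₁‖ = r)
    (hw₂ : ‖w₂‖ = r) (hw : ε ≤ ‖ψ w₁ - ψ w₂‖) :
    ENNReal.ofReal (ε ^ 2 / (2 * Real.pi * r ^ 2)) ≤ ∫⁻ θ in Ioo (-Real.pi) Real.pi,
      (ball (1 : ℂ) 1).indicator (fun z => ENNReal.ofReal (‖deriv ψ z‖ ^ 2))
        (r * (Real.cos θ + Real.sin θ * Complex.I)) := by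
  wlog h12 : w₁.arg ≤ w₂.arg generalizing w₁ w₂
  · exact this h₂ h₁ hw₂ hw₁ (by rwa [norm_sub_rev]) (le_of_not_ge h12)
  set γ : ℝ → ℂ := fun θ => r * (Real.cos θ + Real.sin θ * Complex.I) with hγ
  have hpol : ∀ w : ℂ, ‖w‖ = r → w = γ w.arg := by
    intro w hw
    conv_lhs => rw [← Complex.norm_mul_cos_add_sin_mul_I w, hw]
    simp [hγ]
  have hc1 : r / 2 < Real.cos w₁.arg := by
    rw [hpol _ hw₁] at h₁
    exact (polar_mem_ball_one_iff hr).1 h₁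
  have hc2 : r / 2 < Real.cos w₂.arg := by
    rw [hpol _ hw₂] at h₂
    exact (polar_mem_ball_one_iff hr).1 h₂
  have hpi1 : |w₁.arg| ≤ Real.pi := Complex.abs_arg_le_pi w₁
  have hpi2 : |w₂.arg| ≤ Real.pi := Complex.abs_arg_le_pi w₂
  have hcos : ∀ θ ∈ Icc w₁.arg w₂.arg, γ θ ∈ ball (1 : ℂ) 1 := by
    intro θ hθ
    rw [polar_mem_ball_one_iff hr, ← Real.cos_abs]
    rw [← Real.cos_abs] at hc1 hc2
    rcases le_max_iff.1 (abs_le_max_abs_abs hθ.1 hθ.2) with h | h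
    · exact hc1.trans_le (Real.cos_le_cos_of_nonneg_of_le_pi (abs_nonneg _) hpi1 h)
    · exact hc2.trans_le (Real.cos_le_cos_of_nonneg_of_le_pi (abs_nonneg _) hpi2 h)
  have hγc : Continuous γ := by fun_prop
  have hγd : ∀ θ, HasDerivAt γ (r * (-Real.sin θ + Real.cos θ * Complex.I)) θ := fun θ =>
    ((((Real.hasDerivAt_cos θ).ofReal_comp).add
      (((Real.hasDerivAt_sin θ).ofReal_comp).mul_const Complex.I)).const_mul (r : ℂ)).congr_deriv
      (by push_cast; rfl)
  have hnd : ∀ θ : ℝ, ‖(r * (-Real.sin θ + Real.cos θ * Complex.I) : ℂ)‖ = r := by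
    intro θ
    have h1 : (-Real.sin θ + Real.cos θ * Complex.I : ℂ) =
        Complex.I * Complex.exp (θ * Complex.I) := by
      rw [Complex.exp_mul_I]
      push_cast
      linear_combination (-Complex.sin θ) * Complex.I_sq
    rw [h1, norm_mul, norm_mul, Complex.norm_I, Complex.norm_exp_ofReal_mul_I, Complex.norm_real,
      Real.norm_of_nonneg hr.le, mul_one, mul_one]
  have hψc : ContinuousOn (fun θ => deriv ψ (γ θ)) (Icc w₁.arg w₂.arg) :=
    (hd.deriv isOpen_ball).continuousOn.comp hγc.continuousOn hcos
  have hder : ∀ θ ∈ uIcc w₁.arg w₂.arg, HasDerivAt (fun θ => ψ (γ θ))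
      (deriv ψ (γ θ) * (r * (-Real.sin θ + Real.cos θ * Complex.I))) θ := by
    intro θ hθ
    rw [uIcc_of_le h12] at hθ
    exact ((hd.differentiableAt (isOpen_ball.mem_nhds (hcos θ hθ))).hasDerivAt).comp_of_eq θ
      (hγd θ) rfl
  have hcont : ContinuousOn (fun θ : ℝ => deriv ψ (γ θ) *
      (r * (-Real.sin θ + Real.cos θ * Complex.I))) (uIcc w₁.arg w₂.arg) := by
    rw [uIcc_of_le h12]
    exact hψc.mul (by fun_prop)
  have hftc := intervalIntegral.integral_eq_sub_of_hasDerivAt hder hcont.intervalIntegrable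
  have hle := intervalIntegral.norm_integral_le_integral_norm (μ := volume) h12
    (f := fun θ : ℝ => deriv ψ (γ θ) * (r * (-Real.sin θ + Real.cos θ * Complex.I)))
  rw [hftc, ← hpol _ hw₁, ← hpol _ hw₂, norm_sub_rev] at hle
  have huc : ContinuousOn (fun θ => ‖deriv ψ (γ θ)‖) (uIcc w₁.arg w₂.arg) := by
    rw [uIcc_of_le h12]
    exact hψc.norm
  have hi1 := huc.intervalIntegrable (μ := volume)
  have hi2 : IntervalIntegrable (fun θ => ‖deriv ψ (γ θ)‖ ^ 2) volume w₁.arg w₂.arg :=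
    (huc.pow 2).intervalIntegrable
  have hle' : ε ≤ (∫ θ in w₁.arg..w₂.arg, ‖deriv ψ (γ θ)‖) * r := by
    rw [← intervalIntegral.integral_mul_const]
    refine hw.trans (hle.trans_eq ?_)
    refine intervalIntegral.integral_congr fun θ _ => ?_
    rw [norm_mul, hnd]
  have hpi := Real.pi_pos
  set c : ℝ := ε / (2 * Real.pi * r) with hc
  have hc0 : 0 < c := by positivity
  have hsq : ε ^ 2 / (2 * Real.pi * r ^ 2) ≤ ∫ θ in w₁.arg..w₂.arg, ‖deriv ψ (γ θ)‖ ^ 2 := by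
    have h3 : ∫ θ in w₁.arg..w₂.arg, (2 * c * ‖deriv ψ (γ θ)‖ - c ^ 2) ≤
        ∫ θ in w₁.arg..w₂.arg, ‖deriv ψ (γ θ)‖ ^ 2 :=
      intervalIntegral.integral_mono_on h12
        ((hi1.const_mul (2 * c)).sub intervalIntegrable_const) hi2
        (fun θ _ => by nlinarith [sq_nonneg (‖deriv ψ (γ θ)‖ - c)])
    rw [intervalIntegral.integral_sub (hi1.const_mul (2 * c)) intervalIntegrable_const,
      intervalIntegral.integral_const_mul, intervalIntegral.integral_const, smul_eq_mul] at h3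
    refine le_trans ?_ h3
    have h4 : w₂.arg - w₁.arg ≤ 2 * Real.pi := by
      linarith [(abs_le.1 hpi1).1, (abs_le.1 hpi2).2]
    have h5 : (w₂.arg - w₁.arg) * c ^ 2 ≤ 2 * Real.pi * c ^ 2 := by gcongr
    have h6 : ε / r ≤ ∫ θ in w₁.arg..w₂.arg, ‖deriv ψ (γ θ)‖ := by rwa [div_le_iff₀ hr]
    have h7 := mul_le_mul_of_nonneg_left h6 (show 0 ≤ 2 * c by positivity)
    have h8 : ε ^ 2 / (2 * Real.pi * r ^ 2) = 2 * c * (ε / r) - 2 * Real.pi * c ^ 2 := by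
      rw [hc]
      field_simp
      ring
    linarith
  refine (ENNReal.ofReal_le_ofReal hsq).trans ?_
  rw [intervalIntegral.integral_of_le h12, ofReal_integral_eq_lintegral_ofReal hi2.1
    (Eventually.of_forall fun θ => by positivity)]
  have hsub : Ioc w₁.arg w₂.arg ⊆ Ioo (-Real.pi) Real.pi := by
    intro θ hθ
    refine ⟨(Complex.neg_pi_lt_arg w₁).trans hθ.1, hθ.2.trans_lt ?_⟩
    refine lt_of_le_of_ne (Complex.arg_le_pi w₂) fun h => ?_
    rw [h, Real.cos_pi] at hc2
    linarith
  refine le_trans (setLIntegral_mono' measurableSet_Ioc fun θ hθ => ?_)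
    (lintegral_mono_set hsub)
  rw [indicator_of_mem (hcos θ (Ioc_subset_Icc_self hθ))]

theorem exists_radius_forall_norm_sub_le {ψ : ℂ → ℂ} (hd : DifferentiableOn ℂ ψ (ball 1 1))
    (hi : InjOn ψ (ball 1 1)) (hb : Bornology.IsBounded (ψ '' ball 1 1)) {ε ρ₀ : ℝ} (hε : 0 < ε)
    (hρ₀ : 0 < ρ₀) : ∃ ρ ∈ Ioo 0 ρ₀, ∀ w₁ ∈ ball (1 : ℂ) 1, ∀ w₂ ∈ ball (1 : ℂ) 1,
      ‖w₁‖ = ρ → ‖w₂‖ = ρ → ‖ψ w₁ - ψ w₂‖ ≤ ε := by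
  by_contra hcon
  push Not at hcon
  set F : ℂ → ENNReal :=
    (ball (1 : ℂ) 1).indicator (fun z => ENNReal.ofReal (‖deriv ψ z‖ ^ 2)) with hF
  have hFm : Measurable F :=
    (((measurable_deriv ψ).norm.pow_const 2).ennreal_ofReal).indicator measurableSet_ball
  have h1 : ∫⁻ z, F z < ⊤ := by
    rw [hF, lintegral_indicator measurableSet_ball,
      ← volume_image_eq_lintegral_norm_deriv_sq isOpen_ball hd hi]
    exact hb.measure_lt_top
  have hmeas : Measurable fun p : ℝ × ℝ => ENNReal.ofReal p.1 • F (Complex.polarCoord.symm p) := by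
    have h2 : Measurable fun p : ℝ × ℝ => F (Complex.polarCoord.symm p) := by
      refine hFm.comp ?_
      change Measurable fun p : ℝ × ℝ => (Complex.polarCoord.symm p : ℂ)
      simp only [Complex.polarCoord_symm_apply]
      fun_prop
    exact measurable_fst.ennreal_ofReal.mul h2
  rw [← Complex.lintegral_comp_polarCoord_symm, polarCoord_target, Measure.volume_eq_prod,
    setLIntegral_prod _ hmeas.aemeasurable] at h1
  have h2 : ∫⁻ r in Ioo 0 ρ₀, ENNReal.ofReal (ε ^ 2 / (2 * Real.pi) * r⁻¹) < ⊤ := by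
    refine lt_of_le_of_lt ?_ h1
    refine (setLIntegral_mono' measurableSet_Ioo fun r hr => ?_).trans
      (lintegral_mono_set Ioo_subset_Ioi_self)
    obtain ⟨w₁, h₁, w₂, h₂, hw₁, hw₂, hw⟩ := hcon r hr
    have h3 := le_lintegral_arc hd hr.1 hε h₁ h₂ hw₁ hw₂ hw.le
    simp only [Complex.polarCoord_symm_apply, smul_eq_mul]
    rw [lintegral_const_mul' _ _ ENNReal.ofReal_ne_top]
    refine le_trans (le_of_eq ?_) (mul_le_mul_right h3 _)
    rw [← ENNReal.ofReal_mul hr.1.le]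
    congr 1
    have := hr.1.ne'
    field_simp
  have h4 : IntegrableOn (fun r : ℝ => ε ^ 2 / (2 * Real.pi) * r⁻¹) (Ioo 0 ρ₀) := by
    refine ⟨(by fun_prop : Measurable fun r : ℝ =>
      ε ^ 2 / (2 * Real.pi) * r⁻¹).aestronglyMeasurable, ?_⟩
    rw [hasFiniteIntegral_iff_ofReal]
    · exact h2
    · filter_upwards [ae_restrict_mem measurableSet_Ioo] with r hr
      have := hr.1
      have := Real.pi_pos
      change (0 : ℝ) ≤ _
      positivity
  have h5 : IntervalIntegrable (fun r : ℝ => ε ^ 2 / (2 * Real.pi) * r⁻¹) volume 0 ρ₀ := by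
    rwa [intervalIntegrable_iff_integrableOn_Ioo_of_le hρ₀.le]
  have hc : ε ^ 2 / (2 * Real.pi) ≠ 0 := by positivity
  have h6 := h5.const_mul (ε ^ 2 / (2 * Real.pi))⁻¹
  simp only [inv_mul_cancel_left₀ hc] at h6
  rcases intervalIntegrable_inv_iff.1 h6 with h7 | h7
  · exact hρ₀.ne h7
  · exact h7 left_mem_uIcc

end Crosscuts

/-- `F` and `G` are mutually inverse homeomorphisms of the open unit disk. -/
structure IsDiskHomeo (F G : ℂ → ℂ) : Prop where
  continuousOn : ContinuousOn F (ball 0 1)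
  continuousOn_inv : ContinuousOn G (ball 0 1)
  mapsTo : MapsTo F (ball 0 1) (ball 0 1)
  mapsTo_inv : MapsTo G (ball 0 1) (ball 0 1)
  left_inv : ∀ z ∈ ball (0 : ℂ) 1, G (F z) = z
  right_inv : ∀ z ∈ ball (0 : ℂ) 1, F (G z) = z

/-- Every boundary point of the disk is surrounded by arbitrarily small circular arcs whose image
under `F` is small. -/
def HasShortCrosscuts (F : ℂ → ℂ) : Prop :=
  ∀ ζ ∈ sphere (0 : ℂ) 1, ∀ δ > 0, ∀ ρ₀ > 0, ∃ ρ ∈ Ioo 0 ρ₀, ∀ z₁ ∈ ball (0 : ℂ) 1,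
    ∀ z₂ ∈ ball (0 : ℂ) 1, dist z₁ ζ = ρ → dist z₂ ζ = ρ → dist (F z₁) (F z₂) ≤ δ

namespace IsDiskHomeo

variable {F G : ℂ → ℂ}

theorem exists_radius_lt_norm (H : IsDiskHomeo F G) {η : ℝ} (hη : 0 < η) :
    ∃ r < 1, ∀ z ∈ ball (0 : ℂ) 1, r < ‖z‖ → 1 - η < ‖F z‖ := by
  have hsub : closedBall (0 : ℂ) (1 - η) ⊆ ball 0 1 := closedBall_subset_ball (by linarith)
  have hK : IsCompact (G '' closedBall 0 (1 - η)) :=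
    (isCompact_closedBall _ _).image_of_continuousOn (H.continuousOn_inv.mono hsub)
  have hKB : G '' closedBall 0 (1 - η) ⊆ ball 0 1 := by
    rintro _ ⟨w, hw, rfl⟩
    exact H.mapsTo_inv (hsub hw)
  rcases (G '' closedBall 0 (1 - η)).eq_empty_or_nonempty with he | hne
  · refine ⟨0, zero_lt_one, fun z hz _ => ?_⟩
    by_contra hcon
    have : z ∈ G '' closedBall 0 (1 - η) :=
      ⟨F z, mem_closedBall_zero_iff.2 (not_lt.1 hcon), H.left_inv z hz⟩
    rw [he] at this
    exact this
  · obtain ⟨m, hm, hmax⟩ := hK.exists_isMaxOn hne continuous_norm.continuousOn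
    refine ⟨‖m‖, mem_ball_zero_iff.1 (hKB hm), fun z hz hmz => ?_⟩
    by_contra hcon
    have : z ∈ G '' closedBall 0 (1 - η) :=
      ⟨F z, mem_closedBall_zero_iff.2 (not_lt.1 hcon), H.left_inv z hz⟩
    exact hmz.not_ge (hmax this)

theorem dist_lt_of_mem_cap {u w : ℂ} {η : ℝ} (hu : ‖u‖ = 1) (hw : ‖w‖ < 1)
    (h : 1 - η < (w * (starRingEnd ℂ) u).re) : ‖w - u‖ ^ 2 < 2 * η := by
  have h1 : ‖w - u‖ ^ 2 = ‖w‖ ^ 2 + ‖u‖ ^ 2 - 2 * (w * (starRingEnd ℂ) u).re := by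
    simp only [← Complex.normSq_eq_norm_sq]
    exact Complex.normSq_sub w u
  rw [h1, hu]
  nlinarith [norm_nonneg w]

/-- A homeomorphism of the disk with short crosscuts has small oscillation near boundary points. -/
theorem exists_radius_dist_le (H : IsDiskHomeo F G) (hF : HasShortCrosscuts F) {ζ : ℂ}
    (hζ : ζ ∈ sphere (0 : ℂ) 1) {ε : ℝ} (hε : 0 < ε) : ∃ ρ > 0, ∀ z₁ ∈ ball (0 : ℂ) 1,
      ∀ z₂ ∈ ball (0 : ℂ) 1, dist z₁ ζ < ρ → dist z₂ ζ < ρ → dist (F z₁) (F z₂) ≤ ε := by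
  have h0B : (0 : ℂ) ∈ ball (0 : ℂ) 1 := mem_ball_self one_pos
  have hb : ‖F 0‖ < 1 := mem_ball_zero_iff.1 (H.mapsTo h0B)
  have hζn : ‖ζ‖ = 1 := mem_sphere_zero_iff_norm.1 hζ
  set η : ℝ := min (1 - ‖F 0‖) (ε ^ 2 / 8) with hη
  have hη0 : 0 < η := lt_min (by linarith) (by positivity)
  have hηb : η ≤ 1 - ‖F 0‖ := min_le_left _ _
  have hηε : η ≤ ε ^ 2 / 8 := min_le_right _ _
  obtain ⟨r, hr1, hr⟩ := H.exists_radius_lt_norm (show 0 < η / 4 by positivity)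
  obtain ⟨ρ, hρ, hC⟩ := hF ζ hζ (η / 4) (by positivity) (min 1 (1 - r))
    (lt_min one_pos (by linarith))
  have hρ1 : ρ < 1 := hρ.2.trans_le (min_le_left _ _)
  have hρr : ρ < 1 - r := hρ.2.trans_le (min_le_right _ _)
  have hρ0 := hρ.1
  set z₀ : ℂ := ((1 - ρ : ℝ) : ℂ) * ζ with hz₀
  have hz₀n : ‖z₀‖ = 1 - ρ := by
    rw [hz₀, norm_mul, hζn, mul_one, Complex.norm_real, Real.norm_of_nonneg (by linarith)]
  have hz₀B : z₀ ∈ ball (0 : ℂ) 1 := mem_ball_zero_iff.2 (by linarith)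
  have hz₀ζ : dist z₀ ζ = ρ := by
    rw [dist_eq_norm, show z₀ - ζ = ((-ρ : ℝ) : ℂ) * ζ by rw [hz₀]; push_cast; ring, norm_mul,
      hζn, mul_one, Complex.norm_real, norm_neg, Real.norm_of_nonneg hρ0.le]
  have hw₀ := hr z₀ hz₀B (by linarith)
  have hw₀p : 0 < ‖F z₀‖ := by
    have : η ≤ 1 := by linarith [norm_nonneg (F 0)]
    linarith
  set u : ℂ := F z₀ / ‖F z₀‖ with hu
  have hun : ‖u‖ = 1 := by
    rw [hu, norm_div, Complex.norm_real, norm_norm, div_self hw₀p.ne']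
  have hre : ∀ w : ℂ, (w * (starRingEnd ℂ) u).re ≤ ‖w‖ := fun w => by
    refine (Complex.re_le_norm _).trans_eq ?_
    rw [norm_mul, RCLike.norm_conj, hun, mul_one]
  have hw₀u : (F z₀ * (starRingEnd ℂ) u).re = ‖F z₀‖ := by
    have h1 : F z₀ = ‖F z₀‖ * u := by
      rw [hu, mul_div_cancel₀ _ (Complex.ofReal_ne_zero.2 hw₀p.ne')]
    have h2 : F z₀ * (starRingEnd ℂ) u = ((‖F z₀‖ : ℝ) : ℂ) := by
      conv_lhs => rw [h1]
      rw [mul_assoc, Complex.mul_conj', hun]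
      push_cast
      ring
    rw [h2, Complex.ofReal_re]
  have hcap : ∀ z ∈ ball (0 : ℂ) 1, dist z ζ = ρ → 1 - η < (F z * (starRingEnd ℂ) u).re := by
    intro z hz hzζ
    have h1 := hC z₀ hz₀B z hz hz₀ζ hzζ
    rw [dist_eq_norm] at h1
    have h2 := hre (F z₀ - F z)
    rw [sub_mul, Complex.sub_re, hw₀u] at h2
    linarith
  set K : Set ℂ := ball 0 1 ∩ {w | (w * (starRingEnd ℂ) u).re ≤ 1 - η} with hK
  have hKc : Convex ℝ K := by
    refine (convex_ball _ _).inter ?_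
    refine convex_halfSpace_le (f := fun w : ℂ => (w * (starRingEnd ℂ) u).re) ⟨?_, ?_⟩ _
    · intro x y
      rw [add_mul, Complex.add_re]
    · intro c x
      rw [smul_mul_assoc, Complex.smul_re]
  have hGK : IsPreconnected (G '' K) :=
    hKc.isPreconnected.image _ (H.continuousOn_inv.mono inter_subset_left)
  have hfar : ∀ z ∈ G '' K, ρ < dist z ζ := by
    have hne : ∀ z ∈ G '' K, dist z ζ ≠ ρ := by
      rintro _ ⟨w, hw, rfl⟩ hd
      have h1 := hcap _ (H.mapsTo_inv hw.1) hd
      rw [H.right_inv w hw.1] at h1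
      exact h1.not_ge hw.2
    have h0K : (0 : ℂ) ∈ G '' K :=
      ⟨F 0, ⟨H.mapsTo h0B, (hre _).trans (by linarith)⟩, H.left_inv 0 h0B⟩
    intro z hz
    by_contra hlt
    obtain ⟨y, hy, hyρ⟩ := hGK.intermediate_value hz h0K
      (f := fun z => dist z ζ) (by fun_prop)
      (show ρ ∈ Icc _ _ from ⟨not_lt.1 hlt, by rw [dist_zero_left, hζn]; exact hρ1.le⟩)
    exact hne y hy hyρ
  have hnear : ∀ z ∈ ball (0 : ℂ) 1, dist z ζ < ρ → ‖F z - u‖ ^ 2 < 2 * η := by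
    intro z hz hzρ
    refine dist_lt_of_mem_cap hun (mem_ball_zero_iff.1 (H.mapsTo hz)) ?_
    by_contra hcon
    exact hzρ.not_gt (hfar z ⟨F z, ⟨H.mapsTo hz, not_lt.1 hcon⟩, H.left_inv z hz⟩)
  have hnear' : ∀ z ∈ ball (0 : ℂ) 1, dist z ζ < ρ → dist (F z) u ≤ ε / 2 := by
    intro z hz hzρ
    rw [dist_eq_norm]
    refine le_of_sq_le_sq ?_ (by positivity)
    have := hnear z hz hzρ
    nlinarith
  refine ⟨ρ, hρ0, fun z₁ hz₁ z₂ hz₂ h₁ h₂ => ?_⟩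
  have h3 := dist_triangle_right (F z₁) (F z₂) u
  linarith [hnear' z₁ hz₁ h₁, hnear' z₂ hz₂ h₂]

theorem extendFrom_eq_of_mem (H : IsDiskHomeo F G) {z : ℂ} (hz : z ∈ ball (0 : ℂ) 1) :
    extendFrom (ball 0 1) F z = F z :=
  extendFrom_eq (subset_closure hz) (H.continuousOn z hz)

theorem continuousOn_extendFrom (H : IsDiskHomeo F G) (hF : HasShortCrosscuts F) :
    ContinuousOn (extendFrom (ball 0 1) F) (closedBall 0 1) := by
  have hcl : closure (ball (0 : ℂ) 1) = closedBall 0 1 := closure_ball _ one_ne_zero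
  refine _root_.continuousOn_extendFrom hcl.ge fun ζ hζ => ?_
  by_cases hζB : ζ ∈ ball (0 : ℂ) 1
  · exact ⟨F ζ, H.continuousOn ζ hζB⟩
  have hζs : ζ ∈ sphere (0 : ℂ) 1 := by
    rw [mem_sphere]
    exact le_antisymm hζ (not_lt.1 hζB)
  have : (𝓝[ball (0 : ℂ) 1] ζ).NeBot := mem_closure_iff_nhdsWithin_neBot.1 (hcl ▸ hζ)
  refine CompleteSpace.complete (Metric.cauchy_iff.2 ⟨inferInstance, fun ε hε => ?_⟩)
  obtain ⟨ρ, hρ, h⟩ := H.exists_radius_dist_le hF hζs (half_pos hε)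
  refine ⟨F '' (ball 0 1 ∩ ball ζ ρ), image_mem_map (inter_mem self_mem_nhdsWithin
    (mem_nhdsWithin_of_mem_nhds (ball_mem_nhds ζ hρ))), ?_⟩
  rintro _ ⟨x, hx, rfl⟩ _ ⟨y, hy, rfl⟩
  linarith [h x hx.1 y hy.1 hx.2 hy.2]

theorem extendFrom_mem_sphere (H : IsDiskHomeo F G) (hF : HasShortCrosscuts F) {ζ : ℂ}
    (hζ : ζ ∈ sphere (0 : ℂ) 1) : extendFrom (ball 0 1) F ζ ∈ sphere (0 : ℂ) 1 := by
  have hcl : closure (ball (0 : ℂ) 1) = closedBall 0 1 := closure_ball _ one_ne_zero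
  have hζ' := sphere_subset_closedBall hζ
  have : (𝓝[ball (0 : ℂ) 1] ζ).NeBot := mem_closure_iff_nhdsWithin_neBot.1 (hcl ▸ hζ')
  have ht : Tendsto F (𝓝[ball 0 1] ζ) (𝓝 (extendFrom (ball 0 1) F ζ)) := by
    refine (((H.continuousOn_extendFrom hF) ζ hζ').mono_left
      (nhdsWithin_mono _ ball_subset_closedBall)).congr' ?_
    filter_upwards [self_mem_nhdsWithin] with z hz using H.extendFrom_eq_of_mem hz
  rw [mem_sphere_zero_iff_norm]
  refine le_antisymm (le_of_tendsto ht.norm ?_) (le_of_forall_pos_sub_le fun η hη => ?_)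
  · filter_upwards [self_mem_nhdsWithin] with z hz
    exact (mem_ball_zero_iff.1 (H.mapsTo hz)).le
  · obtain ⟨r, hr1, hr⟩ := H.exists_radius_lt_norm hη
    refine ge_of_tendsto ht.norm ?_
    have h1 : ∀ᶠ z in 𝓝[ball 0 1] ζ, r < ‖z‖ := by
      refine (continuous_norm.continuousWithinAt.eventually (lt_mem_nhds ?_))
      change r < ‖ζ‖
      rwa [mem_sphere_zero_iff_norm.1 hζ]
    filter_upwards [self_mem_nhdsWithin, h1] with z hz hzr
    exact (hr z hz hzr).le

theorem mapsTo_extendFrom (H : IsDiskHomeo F G) (hF : HasShortCrosscuts F) :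
    MapsTo (extendFrom (ball 0 1) F) (closedBall 0 1) (closedBall 0 1) := by
  intro z hz
  rw [← ball_union_sphere] at hz
  rcases hz with hz | hz
  · rw [H.extendFrom_eq_of_mem hz]
    exact ball_subset_closedBall (H.mapsTo hz)
  · exact sphere_subset_closedBall (H.extendFrom_mem_sphere hF hz)

theorem surjOn_extendFrom (H : IsDiskHomeo F G) (hF : HasShortCrosscuts F) :
    SurjOn (extendFrom (ball 0 1) F) (closedBall 0 1) (closedBall 0 1) := by
  have h1 : IsClosed (extendFrom (ball 0 1) F '' closedBall 0 1) :=
    ((isCompact_closedBall _ _).image_of_continuousOn (H.continuousOn_extendFrom hF)).isClosed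
  rw [SurjOn, ← closure_ball (0 : ℂ) one_ne_zero]
  rw [← closure_ball (0 : ℂ) one_ne_zero] at h1
  refine closure_minimal (fun w hw => ?_) h1
  refine ⟨G w, subset_closure (H.mapsTo_inv hw), ?_⟩
  rw [H.extendFrom_eq_of_mem (H.mapsTo_inv hw), H.right_inv w hw]

theorem surjOn_extendFrom_sphere (H : IsDiskHomeo F G) (hF : HasShortCrosscuts F) :
    SurjOn (extendFrom (ball 0 1) F) (sphere 0 1) (sphere 0 1) := by
  intro w hw
  obtain ⟨z, hz, rfl⟩ := H.surjOn_extendFrom hF (sphere_subset_closedBall hw)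
  rw [← ball_union_sphere] at hz
  rcases hz with hz | hz
  · rw [H.extendFrom_eq_of_mem hz] at hw
    exact absurd (mem_sphere.1 hw) (mem_ball.1 (H.mapsTo hz)).ne
  · exact ⟨z, hz, rfl⟩

end IsDiskHomeo

/-- The signed area form which vanishes exactly on the line through `a` and `b`. -/
noncomputable def chordSide (a b z : ℂ) : ℝ := ((z - a) * (starRingEnd ℂ) (b - a)).im

theorem continuous_chordSide (a b : ℂ) : Continuous (chordSide a b) := by
  unfold chordSide
  fun_prop

theorem mem_segment_of_chordSide_eq_zero {a b z : ℂ} (ha : a ∈ sphere (0 : ℂ) 1)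
    (hb : b ∈ sphere (0 : ℂ) 1) (hab : a ≠ b) (hz : z ∈ closedBall (0 : ℂ) 1)
    (h : chordSide a b z = 0) : z ∈ segment ℝ a b := by
  have hd : b - a ≠ 0 := sub_ne_zero.2 hab.symm
  have hd' : 0 < Complex.normSq (b - a) := Complex.normSq_pos.2 hd
  set t : ℝ := ((z - a) * (starRingEnd ℂ) (b - a)).re / Complex.normSq (b - a) with ht
  have hzt : z = a + t * (b - a) := by
    have h1 : (z - a) * (starRingEnd ℂ) (b - a) = ((t * Complex.normSq (b - a) : ℝ) : ℂ) := by
      apply Complex.ext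
      · rw [Complex.ofReal_re, ht, div_mul_cancel₀ _ hd'.ne']
      · rw [Complex.ofReal_im]
        exact h
    have h2 : (starRingEnd ℂ) (b - a) ≠ 0 := (map_ne_zero _).2 hd
    have h3 : z - a = t * (b - a) := by
      apply mul_right_cancel₀ h2
      rw [h1, mul_assoc, Complex.mul_conj]
      push_cast
      rfl
    rw [← h3]
    ring
  have ha1 : Complex.normSq a = 1 := by
    rw [Complex.normSq_eq_norm_sq, mem_sphere_zero_iff_norm.1 ha, one_pow]
  have hb1 : Complex.normSq b = 1 := by
    rw [Complex.normSq_eq_norm_sq, mem_sphere_zero_iff_norm.1 hb, one_pow]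
  have hz1 : Complex.normSq z ≤ 1 := by
    rw [Complex.normSq_eq_norm_sq]
    exact pow_le_one₀ (norm_nonneg _) (mem_closedBall_zero_iff.1 hz)
  have hkey : Complex.normSq z - 1 = Complex.normSq (b - a) * (t ^ 2 - t) := by
    have : Complex.normSq z = (1 - t) * Complex.normSq a + t * Complex.normSq b
        + Complex.normSq (b - a) * (t ^ 2 - t) := by
      rw [hzt]
      simp only [Complex.normSq_apply, Complex.add_re, Complex.add_im, Complex.mul_re,
        Complex.mul_im, Complex.sub_re, Complex.sub_im, Complex.ofReal_re, Complex.ofReal_im]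
      ring
    rw [this, ha1, hb1]
    ring
  have htt : t ^ 2 - t ≤ 0 := by
    by_contra hcon
    have := mul_pos hd' (not_le.1 hcon)
    linarith
  refine ⟨1 - t, t, by nlinarith, by nlinarith, by ring, ?_⟩
  rw [hzt]
  simp only [Complex.real_smul, Complex.ofReal_sub, Complex.ofReal_one]
  ring

theorem exists_mem_sphere_chordSide {a b : ℂ} (ha : a ∈ sphere (0 : ℂ) 1)
    (hb : b ∈ sphere (0 : ℂ) 1) (hab : a ≠ b) :
    (∃ z ∈ sphere (0 : ℂ) 1, chordSide a b z < 0) ∧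
      ∃ z ∈ sphere (0 : ℂ) 1, 0 < chordSide a b z := by
  have hd : b - a ≠ 0 := sub_ne_zero.2 hab.symm
  have hn : 0 < ‖b - a‖ := norm_pos_iff.2 hd
  have hdn : (b - a) * (starRingEnd ℂ) (b - a) = ((‖b - a‖ ^ 2 : ℝ) : ℂ) := by
    rw [Complex.mul_conj, Complex.normSq_eq_norm_sq]
  have hnC : (‖b - a‖ : ℂ) ≠ 0 := Complex.ofReal_ne_zero.2 hn.ne'
  set m : ℂ := a * (starRingEnd ℂ) (b - a) with hm
  have hval : ∀ s : ℝ, chordSide a b (s * Complex.I * ((b - a) / ‖b - a‖)) =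
      s * ‖b - a‖ - m.im := by
    intro s
    have : (s * Complex.I * ((b - a) / ‖b - a‖) - a) * (starRingEnd ℂ) (b - a) =
        ((s * ‖b - a‖ : ℝ) : ℂ) * Complex.I - m := by
      rw [sub_mul, ← hm, mul_assoc, div_mul_eq_mul_div, hdn]
      push_cast
      field_simp
    rw [chordSide, this]
    simp
  have hmem : ∀ s : ℝ, |s| = 1 → (s * Complex.I * ((b - a) / ‖b - a‖)) ∈ sphere (0 : ℂ) 1 := by
    intro s hs
    rw [mem_sphere_zero_iff_norm, norm_mul, norm_mul, norm_div, Complex.norm_real,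
      Complex.norm_real, Real.norm_eq_abs, hs, Complex.norm_I, norm_norm, div_self hn.ne']
    norm_num
  have hmim : |m.im| < ‖b - a‖ := by
    have h1 : ‖m‖ = ‖b - a‖ := by
      rw [hm, norm_mul, mem_sphere_zero_iff_norm.1 ha, one_mul, RCLike.norm_conj]
    rw [← h1]
    refine Complex.abs_im_lt_norm.2 fun h0 => hd ?_
    have ha1 : Complex.normSq a = 1 := by
      rw [Complex.normSq_eq_norm_sq, mem_sphere_zero_iff_norm.1 ha, one_pow]
    have hb1 : Complex.normSq b = 1 := by
      rw [Complex.normSq_eq_norm_sq, mem_sphere_zero_iff_norm.1 hb, one_pow]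
    apply Complex.normSq_eq_zero.1
    have : Complex.normSq (b - a) = Complex.normSq b - Complex.normSq a - 2 * m.re := by
      rw [hm]
      simp only [Complex.normSq_apply, Complex.mul_re, Complex.conj_re, Complex.conj_im,
        Complex.sub_re, Complex.sub_im]
      ring
    rw [this, ha1, hb1, h0]
    ring
  obtain ⟨h1, h2⟩ := abs_lt.1 hmim
  refine ⟨⟨_, hmem (-1) (by norm_num), ?_⟩, ⟨_, hmem 1 (by norm_num), ?_⟩⟩
  · rw [hval]
    linarith
  · rw [hval]
    linarith

theorem exists_exp_of_norm_eq_one {u w : ℂ} (hu : ‖u‖ = 1) (hw : ‖w‖ = 1) (huw : u ≠ w) :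
    ∃ θ ∈ Ioo (-Real.pi) Real.pi, u = -w * Complex.exp (θ * Complex.I) := by
  have hw0 : w ≠ 0 := norm_ne_zero_iff.1 (by rw [hw]; exact one_ne_zero)
  have hn : ‖u / -w‖ = 1 := by rw [norm_div, norm_neg, hu, hw, div_one]
  have h1 := Complex.norm_mul_exp_arg_mul_I (u / -w)
  rw [hn, Complex.ofReal_one, one_mul] at h1
  have h2 : u = -w * Complex.exp ((u / -w).arg * Complex.I) := by
    rw [h1]
    field_simp
  refine ⟨_, ⟨Complex.neg_pi_lt_arg _, lt_of_le_of_ne (Complex.arg_le_pi _) fun h => huw ?_⟩, h2⟩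
  rw [h, Complex.exp_pi_mul_I] at h2
  simpa using h2

theorem isPreconnected_collar {w : ℂ} {η : ℂ → ℝ} (hη : Continuous η) :
    IsPreconnected ((fun p : ℝ × ℝ => (((1 - p.2 * η (-w * Complex.exp (p.1 * Complex.I)) : ℝ) : ℂ)
      * (-w * Complex.exp (p.1 * Complex.I)))) '' Ioo (-Real.pi) Real.pi ×ˢ Ioo 0 1) := by
  refine IsPreconnected.image ?_ _ (Continuous.continuousOn (by fun_prop))
  exact ((convex_Ioo _ _).prod (convex_Ioo _ _)).isPreconnected

theorem mem_collar {w : ℂ} {η : ℂ → ℝ} (hw : ‖w‖ = 1) {x : ℂ} (hx : x ∈ ball (0 : ℂ) 1)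
    (hx0 : x ≠ 0) (hxw : x / ‖x‖ ≠ w) (hxη : 1 - ‖x‖ < η (x / ‖x‖)) :
    x ∈ (fun p : ℝ × ℝ => (((1 - p.2 * η (-w * Complex.exp (p.1 * Complex.I)) : ℝ) : ℂ)
      * (-w * Complex.exp (p.1 * Complex.I)))) '' Ioo (-Real.pi) Real.pi ×ˢ Ioo 0 1 := by
  have hn : 0 < ‖x‖ := norm_pos_iff.2 hx0
  have hx1 : 0 < 1 - ‖x‖ := sub_pos.2 (mem_ball_zero_iff.1 hx)
  obtain ⟨θ, hθ, h⟩ := exists_exp_of_norm_eq_one (u := x / ‖x‖)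
    (by rw [norm_div, Complex.norm_real, norm_norm, div_self hn.ne']) hw hxw
  have hη0 : 0 < η (x / ‖x‖) := hx1.trans hxη
  refine ⟨(θ, (1 - ‖x‖) / η (x / ‖x‖)), ⟨hθ, div_pos hx1 hη0, (div_lt_one hη0).2 hxη⟩, ?_⟩
  change ((1 - (1 - ‖x‖) / η (x / ‖x‖) * η (-w * Complex.exp (θ * Complex.I)) : ℝ) : ℂ) *
    (-w * Complex.exp (θ * Complex.I)) = x
  rw [← h, div_mul_cancel₀ _ hη0.ne', sub_sub_cancel,
    mul_div_cancel₀ _ (Complex.ofReal_ne_zero.2 hn.ne')]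

namespace IsDiskHomeo

variable {F G : ℂ → ℂ}

/-- If two boundary points have the same image, a whole boundary arc collapses. -/
theorem exists_arc_extendFrom_eq (H : IsDiskHomeo F G) (hF : HasShortCrosscuts F) {a b : ℂ}
    (ha : a ∈ sphere (0 : ℂ) 1) (hb : b ∈ sphere (0 : ℂ) 1) (hab : a ≠ b)
    (h : extendFrom (ball 0 1) F a = extendFrom (ball 0 1) F b) :
    ∃ V : Set ℂ, IsOpen V ∧ (sphere (0 : ℂ) 1 ∩ V).Nonempty ∧
      ∀ z ∈ sphere (0 : ℂ) 1 ∩ V, extendFrom (ball 0 1) F z = extendFrom (ball 0 1) F a := by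
  set Fb := extendFrom (ball 0 1) F with hFb
  set w := Fb a with hw
  have hcont : ContinuousOn Fb (closedBall 0 1) := H.continuousOn_extendFrom hF
  have hwn : ‖w‖ = 1 := mem_sphere_zero_iff_norm.1 (H.extendFrom_mem_sphere hF ha)
  have hseg : segment ℝ a b ⊆ closedBall 0 1 :=
    (convex_closedBall _ _).segment_subset (sphere_subset_closedBall ha)
      (sphere_subset_closedBall hb)
  set X : Set ℂ := insert 0 (Fb '' segment ℝ a b) with hX
  have hsegc : IsCompact (segment ℝ a b) := by
    rw [segment_eq_image]
    exact isCompact_Icc.image (by fun_prop)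
  have hXc : IsClosed X :=
    ((hsegc.image_of_continuousOn (hcont.mono hseg)).insert 0).isClosed
  have hXne : X.Nonempty := ⟨0, mem_insert _ _⟩
  have hXw : ∀ u ∈ X, ‖u‖ = 1 → u = w := by
    intro u hu hun
    rcases hu with rfl | ⟨s, hs, rfl⟩
    · simp at hun
    · rw [← insert_endpoints_openSegment] at hs
      rcases hs with rfl | rfl | hs
      · rfl
      · exact h.symm
      · have hsB : s ∈ ball (0 : ℂ) 1 := openSegment_subset_ball_of_ne
          (sphere_subset_closedBall ha) (sphere_subset_closedBall hb) hab hs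
        rw [hFb, H.extendFrom_eq_of_mem hsB] at hun
        exact absurd hun (mem_ball_zero_iff.1 (H.mapsTo hsB)).ne
  set η : ℂ → ℝ := fun u => infDist u X with hη
  have hηc : Continuous η := continuous_infDist_pt X
  have hηpos : ∀ u, ‖u‖ = 1 → u ≠ w → 0 < η u := fun u hu huw =>
    (hXc.notMem_iff_infDist_pos hXne).1 fun hcon => huw (hXw u hcon hu)
  have hη1 : ∀ u, ‖u‖ = 1 → η u ≤ 1 := fun u hu => by
    refine (infDist_le_dist_of_mem (mem_insert 0 _)).trans ?_
    rw [dist_zero_right, hu]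
  have hpre := isPreconnected_collar (w := w) hηc
  set E : Set ℂ := (fun p : ℝ × ℝ => (((1 - p.2 * η (-w * Complex.exp (p.1 * Complex.I)) : ℝ) : ℂ)
      * (-w * Complex.exp (p.1 * Complex.I)))) '' Ioo (-Real.pi) Real.pi ×ˢ Ioo 0 1 with hE
  have hEB : ∀ x ∈ E, x ∈ ball (0 : ℂ) 1 ∧ x ∉ X := by
    rintro _ ⟨⟨θ, τ⟩, ⟨hθ, hτ⟩, rfl⟩
    dsimp only at hθ hτ ⊢
    set u := -w * Complex.exp (θ * Complex.I) with hu
    have hun : ‖u‖ = 1 := by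
      rw [hu, norm_mul, norm_neg, hwn, Complex.norm_exp_ofReal_mul_I, one_mul]
    have huw : u ≠ w := by
      intro hcon
      have hw0 : w ≠ 0 := norm_ne_zero_iff.1 (by rw [hwn]; exact one_ne_zero)
      have h1 : Complex.exp (θ * Complex.I) = -1 := by
        apply mul_left_cancel₀ (neg_ne_zero.2 hw0)
        rw [← hu, hcon]
        ring
      have h2 : Real.cos θ = -1 := by
        rw [← Complex.exp_ofReal_mul_I_re, h1]
        simp
      have h3 : Complex.arg (Complex.exp (θ * Complex.I)) = θ := by
        rw [Complex.arg_exp_mul_I]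
        exact (toIocMod_eq_self _).2 ⟨hθ.1, by linarith [hθ.2]⟩
      rw [h1, Complex.arg_neg_one] at h3
      exact hθ.2.ne' h3
    have hp := hηpos u hun huw
    have hle := hη1 u hun
    have hτη : τ * η u < η u := by nlinarith [hτ.2]
    have hτη0 : 0 < τ * η u := mul_pos hτ.1 hp
    constructor
    · rw [mem_ball_zero_iff, norm_mul, hun, mul_one, Complex.norm_real, Real.norm_eq_abs,
        abs_of_nonneg (by linarith)]
      linarith
    · intro hcon
      have := infDist_le_dist_of_mem (x := u) hcon
      rw [dist_eq_norm] at this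
      have h4 : u - ((1 - τ * η u : ℝ) : ℂ) * u = ((τ * η u : ℝ) : ℂ) * u := by
        push_cast
        ring
      rw [h4, norm_mul, hun, mul_one, Complex.norm_real, Real.norm_eq_abs,
        abs_of_pos hτη0] at this
      exact absurd this (not_le.2 hτη)
  have hGE : IsPreconnected ((fun x => chordSide a b (G x)) '' E) := by
    refine hpre.image _ ((continuous_chordSide a b).comp_continuousOn
      (H.continuousOn_inv.mono fun x hx => (hEB x hx).1))
  have hne0 : ∀ x ∈ E, chordSide a b (G x) ≠ 0 := by
    intro x hx hcon
    obtain ⟨hxB, hxX⟩ := hEB x hx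
    have hGx := H.mapsTo_inv hxB
    refine hxX (mem_insert_of_mem _ ⟨G x, mem_segment_of_chordSide_eq_zero ha hb hab
      (ball_subset_closedBall hGx) hcon, ?_⟩)
    rw [hFb, H.extendFrom_eq_of_mem hGx, H.right_inv x hxB]
  have hside : (∀ x ∈ E, chordSide a b (G x) < 0) ∨ (∀ x ∈ E, 0 < chordSide a b (G x)) := by
    by_contra hcon
    push Not at hcon
    obtain ⟨⟨x, hx, hx0⟩, y, hy, hy0⟩ := hcon
    obtain ⟨z, hz, hz0⟩ := hGE.ordConnected.out (mem_image_of_mem _ hy) (mem_image_of_mem _ hx)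
      ⟨hy0, hx0⟩
    exact hne0 z hz hz0
  have hlim : ∀ z ∈ sphere (0 : ℂ) 1, Fb z ≠ w → ∀ V : Set ℂ, IsOpen V → z ∈ V →
      ∃ x ∈ E, G x ∈ V := by
    intro z hz hzw V hV hzV
    have hz' := sphere_subset_closedBall hz
    have : (𝓝[ball (0 : ℂ) 1] z).NeBot :=
      mem_closure_iff_nhdsWithin_neBot.1 ((closure_ball (0 : ℂ) one_ne_zero).symm ▸ hz')
    have hvn : ‖Fb z‖ = 1 := mem_sphere_zero_iff_norm.1 (H.extendFrom_mem_sphere hF hz)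
    have hv0 : Fb z ≠ 0 := norm_ne_zero_iff.1 (by rw [hvn]; exact one_ne_zero)
    have ht : Tendsto Fb (𝓝[ball 0 1] z) (𝓝 (Fb z)) :=
      (hcont z hz').mono_left (nhdsWithin_mono _ ball_subset_closedBall)
    have hdiv : Fb z / ‖Fb z‖ = Fb z := by rw [hvn, Complex.ofReal_one, div_one]
    have hc1 : ContinuousAt (fun x : ℂ => x / ‖x‖) (Fb z) :=
      continuousAt_id.div (Complex.continuous_ofReal.comp continuous_norm).continuousAt
        (by simpa using hv0)
    have e1 : ∀ᶠ x in 𝓝 (Fb z), x ≠ 0 := isOpen_ne.mem_nhds hv0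
    have e2 : ∀ᶠ x in 𝓝 (Fb z), x / ‖x‖ ≠ w :=
      hc1.eventually_ne (by rwa [hdiv])
    have e3 : ∀ᶠ x in 𝓝 (Fb z), 1 - ‖x‖ < η (x / ‖x‖) := by
      refine ContinuousAt.eventually_lt (by fun_prop) (hηc.continuousAt.comp hc1) ?_
      change 1 - ‖Fb z‖ < η (Fb z / ‖Fb z‖)
      rw [hdiv, hvn, sub_self]
      exact hηpos _ hvn hzw
    have e4 : ∀ᶠ x in 𝓝[ball 0 1] z, x ∈ V := nhdsWithin_le_nhds (hV.mem_nhds hzV)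
    have e0 : ∀ᶠ x in 𝓝[ball 0 1] z, x ∈ ball (0 : ℂ) 1 := self_mem_nhdsWithin
    obtain ⟨y, hyB, hyV, h1, h2, h3⟩ := (e0.and
      (e4.and ((ht.eventually e1).and ((ht.eventually e2).and (ht.eventually e3))))).exists
    rw [hFb, H.extendFrom_eq_of_mem hyB] at h1 h2 h3
    refine ⟨F y, mem_collar hwn (H.mapsTo hyB) h1 h2 h3, ?_⟩
    rwa [H.left_inv y hyB]
  obtain ⟨hneg, hpos⟩ := exists_mem_sphere_chordSide ha hb hab
  rcases hside with hs | hs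
  · have hVo : IsOpen {z | 0 < chordSide a b z} := isOpen_lt continuous_const
      (continuous_chordSide a b)
    refine ⟨_, hVo, hpos, fun z hz => ?_⟩
    by_contra hcon
    obtain ⟨x, hx, hxV⟩ := hlim z hz.1 hcon _ hVo hz.2
    exact (hs x hx).not_gt hxV
  · have hVo : IsOpen {z | chordSide a b z < 0} := isOpen_lt (continuous_chordSide a b)
      continuous_const
    refine ⟨_, hVo, hneg, fun z hz => ?_⟩
    by_contra hcon
    obtain ⟨x, hx, hxV⟩ := hlim z hz.1 hcon _ hVo hz.2
    exact (hs x hx).not_gt hxV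

end IsDiskHomeo

/-- A holomorphic function on the disk whose boundary values vanish on an arc vanishes at the
center. -/
theorem DiffContOnCl.apply_zero_eq_zero_of_arc {f : ℂ → ℂ} (hf : DiffContOnCl ℂ f (ball 0 1))
    {V : Set ℂ} (hV : IsOpen V) (hne : (sphere (0 : ℂ) 1 ∩ V).Nonempty)
    (h0 : ∀ z ∈ sphere (0 : ℂ) 1 ∩ V, f z = 0) : f 0 = 0 := by
  obtain ⟨z₀, hz₀, hz₀V⟩ := hne
  have hz₀n : ‖z₀‖ = 1 := mem_sphere_zero_iff_norm.1 hz₀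
  obtain ⟨t, htc⟩ := (isCompact_sphere (0 : ℂ) 1).elim_nhds_subcover'
    (fun u _ => (fun z => z₀ / u * z) ⁻¹' V) (fun u hu => by
      have hu0 : u ≠ 0 := norm_ne_zero_iff.1 (by
        rw [mem_sphere_zero_iff_norm.1 hu]; exact one_ne_zero)
      refine (hV.preimage (by fun_prop)).mem_nhds ?_
      change z₀ / u * u ∈ V
      rwa [div_mul_cancel₀ _ hu0])
  have hrot : ∀ u : sphere (0 : ℂ) 1, ∀ z : ℂ, ‖z₀ / u * z‖ = ‖z‖ := by
    intro u z
    rw [norm_mul, norm_div, hz₀n, mem_sphere_zero_iff_norm.1 u.2, div_one, one_mul]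
  set p : ℂ → ℂ := fun z => ∏ u ∈ t, f (z₀ / u * z) with hp
  have hpd : DiffContOnCl ℂ p (ball 0 1) := by
    constructor
    · refine DifferentiableOn.fun_finsetProd fun u _ => ?_
      refine hf.differentiableOn.comp (by fun_prop) fun z hz => ?_
      rw [mem_ball_zero_iff] at hz ⊢
      rwa [hrot]
    · refine continuousOn_finsetProd _ fun u _ => ?_
      refine hf.continuousOn.comp (by fun_prop) fun z hz => ?_
      rw [closure_ball _ one_ne_zero, mem_closedBall_zero_iff] at hz ⊢
      rwa [hrot]
  have hp0 : ∀ z ∈ frontier (ball (0 : ℂ) 1), ‖p z‖ ≤ 0 := by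
    intro z hz
    rw [frontier_ball _ one_ne_zero] at hz
    obtain ⟨u, hu, huV⟩ := mem_iUnion₂.1 (htc hz)
    rw [hp, norm_le_zero_iff]
    refine Finset.prod_eq_zero hu (h0 _ ⟨?_, huV⟩)
    rw [mem_sphere_zero_iff_norm] at hz ⊢
    rwa [hrot]
  have h1 : p 0 = 0 := norm_le_zero_iff.1 (Complex.norm_le_of_forall_mem_frontier_norm_le
    isBounded_ball hpd hp0 (subset_closure (mem_ball_self one_pos)))
  simp only [hp, mul_zero, Finset.prod_const] at h1
  exact eq_zero_of_pow_eq_zero h1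

namespace IsDiskHomeo

variable {F G : ℂ → ℂ}

/-- The boundary extension is injective provided `F` becomes holomorphic after composition with a
homeomorphism of the plane. -/
theorem injOn_extendFrom (H : IsDiskHomeo F G) (hF : HasShortCrosscuts F) {k : ℂ → ℂ}
    (hk : Continuous k) (hki : Function.Injective k)
    (hd : DifferentiableOn ℂ (fun z => k (F z)) (ball 0 1)) :
    InjOn (extendFrom (ball 0 1) F) (closedBall 0 1) := by
  have hlt : ∀ z ∈ ball (0 : ℂ) 1, ‖extendFrom (ball 0 1) F z‖ < 1 := fun z hz => by
    rw [H.extendFrom_eq_of_mem hz]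
    exact mem_ball_zero_iff.1 (H.mapsTo hz)
  have heq : ∀ z ∈ sphere (0 : ℂ) 1, ‖extendFrom (ball 0 1) F z‖ = 1 := fun z hz =>
    mem_sphere_zero_iff_norm.1 (H.extendFrom_mem_sphere hF hz)
  intro a ha b hb hab
  rw [← ball_union_sphere] at ha hb
  rcases ha with ha | ha <;> rcases hb with hb | hb
  · rw [H.extendFrom_eq_of_mem ha, H.extendFrom_eq_of_mem hb] at hab
    rw [← H.left_inv a ha, hab, H.left_inv b hb]
  · exact absurd (hab ▸ hlt a ha) (heq b hb).not_lt
  · exact absurd (hab ▸ hlt b hb) (heq a ha).not_lt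
  by_contra hne
  obtain ⟨V, hV, hVne, h⟩ := H.exists_arc_extendFrom_eq hF ha hb hne hab
  have hdc : DiffContOnCl ℂ (fun z => k (extendFrom (ball 0 1) F z)
      - k (extendFrom (ball 0 1) F a)) (ball 0 1) := by
    refine DiffContOnCl.sub_const ⟨hd.congr fun z hz => ?_, ?_⟩ _
    · rw [H.extendFrom_eq_of_mem hz]
    · rw [closure_ball _ one_ne_zero]
      exact hk.comp_continuousOn (H.continuousOn_extendFrom hF)
  have h0 := hdc.apply_zero_eq_zero_of_arc hV hVne fun z hz => by rw [h z hz, sub_self]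
  have h1 := hki (sub_eq_zero.1 h0)
  have h2 := hlt 0 (mem_ball_self one_pos)
  rw [h1] at h2
  exact h2.ne (heq a ha)

end IsDiskHomeo

theorem exists_cone_homeomorph {f : ℂ → ℂ} (hc : ContinuousOn f (sphere 0 1))
    (hm : MapsTo f (sphere 0 1) (sphere 0 1)) (hi : InjOn f (sphere 0 1))
    (hs : SurjOn f (sphere 0 1) (sphere 0 1)) :
    ∃ P : ℂ ≃ₜ ℂ, (∀ z, ‖P z‖ = ‖z‖) ∧ (∀ (r : ℝ) (z : ℂ), 0 ≤ r → P (r * z) = r * P z) ∧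
      ∀ z, P z = ‖z‖ * f (z / ‖z‖) := by
  set T : ℂ → ℂ := fun z => ‖z‖ * f (z / ‖z‖) with hT
  have hsph : ∀ z : ℂ, z ≠ 0 → z / ‖z‖ ∈ sphere (0 : ℂ) 1 := by
    intro z hz
    rw [mem_sphere_zero_iff_norm, norm_div, Complex.norm_real, norm_norm,
      div_self (norm_ne_zero_iff.2 hz)]
  have hC : ∀ z : ℂ, z ≠ 0 → (‖z‖ : ℂ) ≠ 0 := fun z hz =>
    Complex.ofReal_ne_zero.2 (norm_ne_zero_iff.2 hz)
  have hn : ∀ z, ‖T z‖ = ‖z‖ := by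
    intro z
    rcases eq_or_ne z 0 with rfl | hz
    · simp [hT]
    · rw [hT, norm_mul, Complex.norm_real, norm_norm,
        mem_sphere_zero_iff_norm.1 (hm (hsph z hz)), mul_one]
  have hcont : Continuous T := by
    refine continuous_iff_continuousAt.2 fun z => ?_
    rcases eq_or_ne z 0 with rfl | hz
    · have h0 : T 0 = 0 := norm_eq_zero.1 (by rw [hn, norm_zero])
      rw [ContinuousAt, h0, tendsto_zero_iff_norm_tendsto_zero]
      simp only [hn]
      exact tendsto_norm_zero
    · have h1 : ContinuousOn (fun z : ℂ => f (z / ‖z‖)) {0}ᶜ := by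
        refine hc.comp (ContinuousOn.div continuousOn_id (by fun_prop) fun z hz => hC z hz) ?_
        exact fun z hz => hsph z hz
      exact ((Complex.continuous_ofReal.comp continuous_norm).continuousAt).mul
        (h1.continuousAt (isOpen_compl_singleton.mem_nhds hz))
  have hinj : Function.Injective T := by
    intro z z' h
    have hnn : ‖z‖ = ‖z'‖ := by rw [← hn z, h, hn]
    rcases eq_or_ne z 0 with rfl | hz
    · rw [norm_zero] at hnn
      exact (norm_eq_zero.1 hnn.symm).symm
    · have hz' : z' ≠ 0 := norm_ne_zero_iff.1 (hnn ▸ norm_ne_zero_iff.2 hz)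
      simp only [hT, ← hnn] at h
      have h2 := mul_left_cancel₀ (hC z hz) h
      have h3 := hi (hsph z hz) (by simpa only [← hnn] using hsph z' hz') h2
      exact (div_left_inj' (hC z hz)).1 h3
  have hsurj : Function.Surjective T := by
    intro w
    rcases eq_or_ne w 0 with rfl | hw
    · exact ⟨0, norm_eq_zero.1 (by rw [hn, norm_zero])⟩
    · obtain ⟨z, hz, hzw⟩ := hs (hsph w hw)
      have hnz : ‖(‖w‖ : ℂ) * z‖ = ‖w‖ := by
        rw [norm_mul, mem_sphere_zero_iff_norm.1 hz, Complex.norm_real, norm_norm, mul_one]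
      refine ⟨‖w‖ * z, ?_⟩
      simp only [hT, hnz]
      rw [mul_div_cancel_left₀ _ (hC w hw), hzw, mul_div_cancel₀ _ (hC w hw)]
  obtain ⟨P, hP⟩ := exists_homeomorph_of_bijective hcont ⟨hinj, hsurj⟩
    (by simpa only [hn] using tendsto_norm_cocompact_atTop)
  refine ⟨P, fun z => by rw [hP, hn], fun r z hr => ?_, hP⟩
  rw [hP, hP]
  rcases hr.eq_or_lt with rfl | hr
  · simp [hT]
  · simp only [hT]
    have hrC : (r : ℂ) ≠ 0 := Complex.ofReal_ne_zero.2 hr.ne'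
    rw [norm_mul, Complex.norm_real, Real.norm_eq_abs, abs_of_pos hr, Complex.ofReal_mul,
      mul_div_mul_left _ _ hrC, mul_assoc]

/-- A homeomorphism of the closed disk extends radially to the plane. -/
theorem exists_homeomorph_extension {f : ℂ → ℂ} (hc : ContinuousOn f (closedBall 0 1))
    (hm : MapsTo f (closedBall 0 1) (closedBall 0 1))
    (hms : MapsTo f (sphere 0 1) (sphere 0 1)) (hi : InjOn f (closedBall 0 1))
    (hs : SurjOn f (closedBall 0 1) (closedBall 0 1))
    (hss : SurjOn f (sphere 0 1) (sphere 0 1)) :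
    ∃ P K : ℂ ≃ₜ ℂ, (∀ z, ‖P z‖ = ‖z‖) ∧ (∀ (r : ℝ) (z : ℂ), 0 ≤ r → P (r * z) = r * P z) ∧
      (∀ z, ‖z‖ ≤ 1 → K z = f z) ∧ ∀ z, 1 ≤ ‖z‖ → K z = P z := by
  obtain ⟨P, hPn, hPr, hP⟩ := exists_cone_homeomorph (hc.mono sphere_subset_closedBall) hms
    (hi.mono sphere_subset_closedBall) hss
  set T : ℂ → ℂ := fun z => ((max 1 ‖z‖ : ℝ) : ℂ) * f (z / ((max 1 ‖z‖ : ℝ) : ℂ)) with hT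
  have hmax : ∀ z : ℂ, 0 < max 1 ‖z‖ := fun z => lt_max_of_lt_left one_pos
  have hin : ∀ z, ‖z‖ ≤ 1 → T z = f z := fun z hz => by simp [hT, max_eq_left hz]
  have hout : ∀ z, 1 ≤ ‖z‖ → T z = P z := fun z hz => by simp only [hT, max_eq_right hz, hP]
  have hcont : Continuous T := by
    refine Continuous.mul (by fun_prop) (hc.comp_continuous ?_ fun z => ?_)
    · exact continuous_id.div (by fun_prop) fun z => Complex.ofReal_ne_zero.2 (hmax z).ne'
    · rw [mem_closedBall_zero_iff, norm_div, Complex.norm_real, Real.norm_eq_abs,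
        abs_of_pos (hmax z), div_le_one (hmax z)]
      exact le_max_right _ _
  have hle : ∀ z, ‖z‖ ≤ 1 → ‖T z‖ ≤ 1 := fun z hz => by
    rw [hin z hz]
    exact mem_closedBall_zero_iff.1 (hm (mem_closedBall_zero_iff.2 hz))
  have hno : ∀ z, 1 ≤ ‖z‖ → ‖T z‖ = ‖z‖ := fun z hz => by rw [hout z hz, hPn]
  have hinj : Function.Injective T := by
    intro a b hab
    rcases le_total ‖a‖ 1 with ha | ha <;> rcases le_total ‖b‖ 1 with hb | hb
    · rw [hin a ha, hin b hb] at hab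
      exact hi (mem_closedBall_zero_iff.2 ha) (mem_closedBall_zero_iff.2 hb) hab
    · have h1 := hle a ha
      rw [hab, hno b hb] at h1
      rw [hin a ha, hin b h1] at hab
      exact hi (mem_closedBall_zero_iff.2 ha) (mem_closedBall_zero_iff.2 h1) hab
    · have h1 := hle b hb
      rw [← hab, hno a ha] at h1
      rw [hin a h1, hin b hb] at hab
      exact hi (mem_closedBall_zero_iff.2 h1) (mem_closedBall_zero_iff.2 hb) hab
    · rw [hout a ha, hout b hb] at hab
      exact P.injective hab
  have hsurj : Function.Surjective T := by
    intro w
    rcases le_total ‖w‖ 1 with hw | hw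
    · obtain ⟨z, hz, rfl⟩ := hs (mem_closedBall_zero_iff.2 hw)
      exact ⟨z, hin z (mem_closedBall_zero_iff.1 hz)⟩
    · obtain ⟨z, rfl⟩ := P.surjective w
      rw [hPn] at hw
      exact ⟨z, hout z hw⟩
  have htend : Tendsto (fun z => ‖T z‖) (cocompact ℂ) atTop := by
    refine tendsto_norm_cocompact_atTop.congr' ?_
    filter_upwards [tendsto_norm_cocompact_atTop.eventually_ge_atTop 1] with z hz
    exact (hno z hz).symm
  obtain ⟨K, hK⟩ := exists_homeomorph_of_bijective hcont ⟨hinj, hsurj⟩ htend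
  exact ⟨P, K, hPn, hPr, fun z hz => by rw [hK, hin z hz], fun z hz => by rw [hK, hout z hz]⟩

/-- The inverse of an injective holomorphic map onto the disk is holomorphic. -/
theorem hasStrictDerivAt_invFunOn {U : Set ℂ} (hU : IsOpen U) {f : ℂ → ℂ}
    (hf : DifferentiableOn ℂ f U) (hi : InjOn f U) (h0 : ∀ z ∈ U, deriv f z ≠ 0) {z : ℂ}
    (hz : z ∈ f '' U) : ∃ c ≠ 0, HasStrictDerivAt (Function.invFunOn f U) c z := by
  have key : ∀ x ∈ U, f '' U ∈ 𝓝 (f x) ∧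
      HasDerivAt (Function.invFunOn f U) (deriv f x)⁻¹ (f x) := by
    intro x hx
    have hs : HasStrictDerivAt f (deriv f x) x :=
      (hf.analyticAt (hU.mem_nhds hx)).hasStrictDerivAt
    have hmap := hs.map_nhds_eq (h0 x hx)
    have hinv : Function.invFunOn f U (f x) = x := hi.leftInvOn_invFunOn hx
    have hnhds : f '' U ∈ 𝓝 (f x) := by
      rw [← hmap]
      exact image_mem_map (hU.mem_nhds hx)
    refine ⟨hnhds, HasDerivAt.of_local_left_inverse ?_ (by rw [hinv]; exact hs.hasDerivAt)
      (h0 x hx) ?_⟩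
    · rw [ContinuousAt, hinv, ← hmap, tendsto_map'_iff]
      refine tendsto_id.congr' ?_
      filter_upwards [hU.mem_nhds hx] with y hy
      exact (hi.leftInvOn_invFunOn hy).symm
    · filter_upwards [hnhds] with y hy
      exact Function.invFunOn_eq hy
  obtain ⟨x, hx, rfl⟩ := hz
  obtain ⟨hnhds, hderiv⟩ := key x hx
  refine ⟨_, inv_ne_zero (h0 x hx), ?_⟩
  have hopen : IsOpen (f '' U) := isOpen_iff_mem_nhds.2 (by
    rintro _ ⟨y, hy, rfl⟩
    exact (key y hy).1)
  have hdiff : DifferentiableOn ℂ (Function.invFunOn f U) (f '' U) := by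
    rintro _ ⟨y, hy, rfl⟩
    exact (key y hy).2.differentiableAt.differentiableWithinAt
  have := (hdiff.analyticAt hnhds).hasStrictDerivAt
  rwa [hderiv.deriv] at this

theorem hasShortCrosscuts_symm_comp (h : ℂ ≃ₜ ℂ) {φ : ℂ → ℂ}
    (hd : DifferentiableOn ℂ φ (ball 0 1)) (hi : InjOn φ (ball 0 1))
    (hm : MapsTo φ (ball 0 1) (h '' ball 0 1)) : HasShortCrosscuts fun z => h.symm (φ z) := by
  intro ζ hζ δ hδ ρ₀ hρ₀
  have hζn : ‖ζ‖ = 1 := mem_sphere_zero_iff_norm.1 hζ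
  have hζ0 : ζ ≠ 0 := norm_ne_zero_iff.1 (by rw [hζn]; exact one_ne_zero)
  have hK : IsCompact (h '' closedBall 0 1) := (isCompact_closedBall _ _).image h.continuous
  have hsub : h '' ball 0 1 ⊆ h '' closedBall 0 1 := image_mono ball_subset_closedBall
  obtain ⟨ε, hε, huc⟩ := Metric.uniformContinuousOn_iff.1
    (hK.uniformContinuousOn_of_continuous h.symm.continuous.continuousOn) δ hδ
  have hball : ∀ w, w ∈ ball (1 : ℂ) 1 ↔ ζ * (1 - w) ∈ ball (0 : ℂ) 1 := by
    intro w
    rw [mem_ball_zero_iff, norm_mul, hζn, one_mul, mem_ball, dist_eq_norm, norm_sub_rev]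
  obtain ⟨ρ, hρ, hle⟩ := exists_radius_forall_norm_sub_le (ψ := fun w => φ (ζ * (1 - w)))
    (hd.comp (by fun_prop) fun w hw => (hball w).1 hw)
    (fun w hw w' hw' hww => by
      have := mul_left_cancel₀ hζ0 (hi ((hball w).1 hw) ((hball w').1 hw') hww)
      exact sub_right_injective this)
    (hK.isBounded.subset (by
      rintro _ ⟨w, hw, rfl⟩
      exact hsub (hm ((hball w).1 hw)))) (half_pos hε) hρ₀
  refine ⟨ρ, hρ, fun z₁ hz₁ z₂ hz₂ h₁ h₂ => ?_⟩
  have hz : ∀ z, ζ * (1 - (1 - z / ζ)) = z := fun z => by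
    field_simp
    ring
  have hzn : ∀ z, ‖1 - z / ζ‖ = dist z ζ := fun z => by
    have : ζ * (1 - z / ζ) = ζ - z := by
      field_simp
    rw [dist_comm, dist_eq_norm, ← this, norm_mul, hζn, one_mul]
  have := hle (1 - z₁ / ζ) ((hball _).2 (by rwa [hz])) (1 - z₂ / ζ) ((hball _).2 (by rwa [hz]))
    (by rw [hzn, h₁]) (by rw [hzn, h₂])
  simp only [hz] at this
  refine (huc _ (hsub (hm hz₁)) _ (hsub (hm hz₂)) ?_).le
  rw [dist_eq_norm]
  linarith

/-- Every homeomorphism of the plane becomes holomorphic near the origin after composition with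
one which is conical outside the unit disk. -/
theorem exists_conical_mul_hasStrictDerivAt (h : ℂ ≃ₜ ℂ) :
    ∃ P K : ℂ ≃ₜ ℂ, (∀ z, ‖P z‖ = ‖z‖) ∧ (∀ (r : ℝ) (z : ℂ), 0 ≤ r → P (r * z) = r * P z) ∧
      (∀ z, 1 ≤ ‖z‖ → K z = P z) ∧ ∃ c ≠ 0, HasStrictDerivAt (h * K) c 0 := by
  set Ω : Set ℂ := h '' ball 0 1 with hΩ
  have hΩo : IsOpen Ω := h.isOpenMap _ isOpen_ball
  have hΩc : IsSimplyConnected Ω := h.isSimplyConnected_image.2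
    ((convex_ball _ _).isSimplyConnected (nonempty_ball.2 one_pos))
  have hΩb : Bornology.IsBounded Ω := (((isCompact_closedBall (0 : ℂ) 1).image
    h.continuous).isBounded).subset (image_mono ball_subset_closedBall)
  obtain ⟨f, hfd, hfi, hf0, hfU⟩ := exists_biholomorphic_to_ball hΩo hΩc hΩb
  set φ := Function.invFunOn f Ω with hφ
  have hex : ∀ z ∈ ball (0 : ℂ) 1, z ∈ f '' Ω := hfU.ge
  have hφs : ∀ z ∈ ball (0 : ℂ) 1, ∃ c ≠ 0, HasStrictDerivAt φ c z := fun z hz =>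
    hasStrictDerivAt_invFunOn hΩo hfd hfi hf0 (hex z hz)
  have hφd : DifferentiableOn ℂ φ (ball 0 1) := fun z hz => by
    obtain ⟨c, -, hc⟩ := hφs z hz
    exact hc.hasDerivAt.differentiableAt.differentiableWithinAt
  have hφm : MapsTo φ (ball 0 1) Ω := fun z hz => Function.invFunOn_mem (hex z hz)
  have hfφ : ∀ z ∈ ball (0 : ℂ) 1, f (φ z) = z := fun z hz => Function.invFunOn_eq (hex z hz)
  have hφi : InjOn φ (ball 0 1) := LeftInvOn.injOn hfφ
  have hfm : MapsTo f Ω (ball 0 1) := fun x hx => hfU ▸ mem_image_of_mem f hx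
  have hhm : MapsTo h (ball 0 1) Ω := mapsTo_image _ _
  have H : IsDiskHomeo (fun z => h.symm (φ z)) (fun z => f (h z)) :=
    { continuousOn := h.symm.continuous.comp_continuousOn hφd.continuousOn
      continuousOn_inv := hfd.continuousOn.comp h.continuous.continuousOn hhm
      mapsTo := fun z hz => by
        obtain ⟨x, hx, hxz⟩ := hφm hz
        change h.symm (φ z) ∈ _
        rwa [← hxz, h.symm_apply_apply]
      mapsTo_inv := fun z hz => hfm (hhm hz)
      left_inv := fun z hz => by rw [h.apply_symm_apply, hfφ z hz]
      right_inv := fun z hz => by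
        rw [hφ, hfi.leftInvOn_invFunOn (hhm hz), h.symm_apply_apply] }
  have hF := hasShortCrosscuts_symm_comp h hφd hφi hφm
  have hinj := H.injOn_extendFrom hF h.continuous h.injective
    (hφd.congr fun z _ => h.apply_symm_apply _)
  obtain ⟨P, K, hPn, hPr, hKin, hKout⟩ := exists_homeomorph_extension
    (H.continuousOn_extendFrom hF) (H.mapsTo_extendFrom hF)
    (fun z hz => H.extendFrom_mem_sphere hF hz) hinj (H.surjOn_extendFrom hF)
    (H.surjOn_extendFrom_sphere hF)
  obtain ⟨c, hc, hcs⟩ := hφs 0 (mem_ball_self one_pos)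
  refine ⟨P, K, hPn, hPr, hKout, c, hc, hcs.congr_of_eventuallyEq ?_⟩
  filter_upwards [ball_mem_nhds (0 : ℂ) one_pos] with z hz
  rw [Homeomorph.mul_apply', hKin z (mem_ball_zero_iff.1 hz).le, H.extendFrom_eq_of_mem hz,
    h.apply_symm_apply]

theorem commutator_homeo_complex_eq_ker : commutator (ℂ ≃ₜ ℂ) = degreeHom.ker := by
  have hle : commutator (ℂ ≃ₜ ℂ) ≤ degreeHom.ker := Abelianization.commutator_subset_ker _
  refine le_antisymm hle fun h hh => ?_
  obtain ⟨P, K, hPn, hPr, hK, c, hc, hcs⟩ := exists_conical_mul_hasStrictDerivAt h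
  have h1 : h * K ∈ commutator (ℂ ≃ₜ ℂ) := mem_commutator_of_hasStrictDerivAt hc hcs
  have h2 : K * P⁻¹ ∈ commutator (ℂ ≃ₜ ℂ) := by
    refine mem_commutator_of_eqOn_open (one_mem _) (U := {z | 1 < ‖z‖})
      (isOpen_lt continuous_const continuous_norm) ⟨2, by simp⟩ fun z hz => ?_
    have hz' : 1 ≤ ‖P⁻¹ z‖ := by
      rw [← hPn, Homeomorph.apply_inv_self']
      exact le_of_lt hz
    rw [Homeomorph.mul_apply', hK _ hz', Homeomorph.apply_inv_self', Homeomorph.one_apply']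
  have h3 : degreeHom P = 1 := by
    have e1 := MonoidHom.mem_ker.1 (hle h1)
    have e2 := MonoidHom.mem_ker.1 (hle h2)
    rw [map_mul, MonoidHom.mem_ker.1 hh, one_mul] at e1
    rwa [map_mul, e1, one_mul, map_inv, inv_eq_one] at e2
  have h4 := mem_commutator_of_cone hPn hPr h3
  have : h = h * K * (P⁻¹ * (K * P⁻¹)⁻¹) := by group
  rw [this]
  exact mul_mem h1 (mul_mem (inv_mem h4) (inv_mem h2))

theorem commutator_homeo_complex_index : (commutator (ℂ ≃ₜ ℂ)).index = 2 := by
  have hr : degreeHom.range = ⊤ := by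
    refine MonoidHom.range_eq_top.2 fun u => ?_
    rcases Int.units_eq_one_or u with rfl | rfl
    · exact ⟨1, map_one _⟩
    · exact ⟨_, degreeHom_conj⟩
  rw [commutator_homeo_complex_eq_ker, Subgroup.index_ker, hr, Subgroup.card_top,
    Nat.card_eq_fintype_card, Fintype.card_units_int]

/-- The isomorphism of homeomorphism groups induced by a homeomorphism. -/
def Homeomorph.conjMulEquiv {X Y : Type*} [TopologicalSpace X] [TopologicalSpace Y] (e : X ≃ₜ Y) :
    (X ≃ₜ X) ≃* (Y ≃ₜ Y) where
  toFun h := (e.symm.trans h).trans e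
  invFun h := (e.trans h).trans e.symm
  left_inv h := by ext; simp
  right_inv h := by ext; simp
  map_mul' h k := by ext; simp

theorem commutator_index_congr {G G' : Type*} [Group G] [Group G'] (e : G ≃* G') :
    (commutator G').index = (commutator G).index := by
  rw [← Subgroup.index_map_equiv (commutator G) e, commutator_def, commutator_def,
    Subgroup.map_commutator]
  congr 2 <;> exact (Subgroup.map_top_of_surjective _ e.surjective).symm

/-- The commutator subgroup of `Homeo(ℝ²)` has index `2`. -/
theorem commutator_homeo_euclideanPlane_index_eq_two :
    (commutator (EuclideanSpace ℝ (Fin 2) ≃ₜ EuclideanSpace ℝ (Fin 2))).index = 2 := by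
  rw [commutator_index_congr
    Complex.orthonormalBasisOneI.repr.toHomeomorph.conjMulEquiv, commutator_homeo_complex_index]
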